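/- arXiv:2603.08121 — 2 statements merged into one kernel-verified Lean document; each statement's English description precedes it below -/
import Mathlib

section
/- Let d > 1 and ℓ be positive integers with 2ℓ ≥ d. There exists a constant c > 0 (depending only on d and ℓ) such that for every real B > 0 there exists a number field K of degree d over ℚ with D_K > B and M_{K,ℓ} ≥ c · D_K^{−1/(2ℓ(d−1))}. (This and the upper bound M_{K,ℓ} ≤ 2·D_K^{−1/(2ℓ(d−1))} give Ellenberg's invariant f(ℓ,d) = 1/(2ℓ(d−1)) whenever ℓ ≥ d/2.) -/
open NumberField Polynomial

/-- The denominator ideal of `α ∈ K`: the set of `x ∈ 𝓞 K` with `x·α ∈ 𝓞 K`.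
Its absolute norm is the non-archimedean part `∏_v max(1,|α|_v)^{d_v}` of the height. -/
noncomputable def denIdeal (K : Type*) [Field K] [NumberField K] (α : K) : Ideal (𝓞 K) where
  carrier := {x : 𝓞 K | ∃ y : 𝓞 K, (x : K) * α = (y : K)}
  zero_mem' := ⟨0, by simp⟩
  add_mem' := by
    rintro a b ⟨ya, ha⟩ ⟨yb, hb⟩
    exact ⟨ya + yb, by push_cast; rw [add_mul, ha, hb]⟩
  smul_mem' := by
    rintro c x ⟨y, hy⟩
    exact ⟨c * y, by rw [smul_eq_mul]; push_cast; rw [mul_assoc, hy]⟩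

/-- The relative multiplicative Weil height `H_K(α) = ∏_{v ∈ M_K} max(1,|α|_v)^{d_v}`. -/
noncomputable def heightK (K : Type*) [Field K] [NumberField K] (α : K) : ℝ :=
  (Ideal.absNorm (denIdeal K α) : ℝ) * ∏ w : InfinitePlace K, max 1 (w α) ^ w.mult

/-- `N'_K(X)`: the number of `α ∈ K` with `ℚ(α) = K` and `H_K(α) < X`. -/
noncomputable def NprimeK (K : Type*) [Field K] [NumberField K] (X : ℝ) : ℕ :=
  Nat.card {α : K // IntermediateField.adjoin ℚ {α} = ⊤ ∧ heightK K α < X}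

/-- `M_{K,ℓ} = inf_{X > 0} X^{-1/ℓ}(1 + N'_K(X))`. -/
noncomputable def MKl (K : Type*) [Field K] [NumberField K] (ℓ : ℕ) : ℝ :=
  ⨅ X : {X : ℝ // 0 < X}, (X : ℝ) ^ (-(1:ℝ)/ℓ) * (1 + (NprimeK K X : ℝ))

/-- `η(K)`: the minimal height of a primitive element of `K`. -/
noncomputable def etaK (K : Type*) [Field K] [NumberField K] : ℝ :=
  sInf {x : ℝ | ∃ α : K, IntermediateField.adjoin ℚ {α} = ⊤ ∧ heightK K α = x}

/-- `D_K`: the absolute value of the discriminant. -/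
noncomputable def DK (K : Type*) [Field K] [NumberField K] : ℕ :=
  (NumberField.discr K).natAbs

section HeightBasics

theorem one_le_max_pow_mult {K : Type*} [Field K] (α : K) (w : InfinitePlace K) :
    (1 : ℝ) ≤ max 1 (w α) ^ w.mult :=
  one_le_pow₀ (le_max_left _ _)

variable {K : Type*} [Field K] [NumberField K]

theorem mem_denIdeal {α : K} {x : 𝓞 K} :
    x ∈ denIdeal K α ↔ ∃ y : 𝓞 K, (x : K) * α = (y : K) := Iff.rfl

theorem denIdeal_ne_bot (α : K) : denIdeal K α ≠ ⊥ := by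
  obtain ⟨⟨y, s⟩, hs⟩ := IsLocalization.surj (nonZeroDivisors (𝓞 K)) α
  intro h
  have hmem : (s : 𝓞 K) ∈ denIdeal K α := ⟨y, by rw [mul_comm]; exact hs⟩
  rw [h, Ideal.mem_bot] at hmem
  exact nonZeroDivisors.coe_ne_zero s hmem

theorem one_le_absNorm_denIdeal (α : K) : 1 ≤ Ideal.absNorm (denIdeal K α) :=
  Nat.one_le_iff_ne_zero.mpr fun h => denIdeal_ne_bot α (Ideal.absNorm_eq_zero_iff.mp h)

theorem absNorm_denIdeal_le_heightK (α : K) :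
    (Ideal.absNorm (denIdeal K α) : ℝ) ≤ heightK K α :=
  le_mul_of_one_le_right (Nat.cast_nonneg _)
    (Finset.one_le_prod fun w _ => one_le_max_pow_mult α w)

theorem infinitePlace_le_heightK (α : K) (w : InfinitePlace K) : w α ≤ heightK K α := by
  classical
  have h1 : w α ≤ max 1 (w α) ^ w.mult :=
    (le_max_right _ _).trans (le_self_pow₀ (le_max_left _ _) InfinitePlace.mult_ne_zero)
  have h2 : max 1 (w α) ^ w.mult ≤ ∏ v : InfinitePlace K, max 1 (v α) ^ v.mult := by
    rw [← Finset.mul_prod_erase _ _ (Finset.mem_univ w)]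
    exact le_mul_of_one_le_right (zero_le_one.trans (one_le_max_pow_mult α w))
      (Finset.one_le_prod fun v _ => one_le_max_pow_mult α v)
  have h3 : (1 : ℝ) ≤ Ideal.absNorm (denIdeal K α) := by
    exact_mod_cast one_le_absNorm_denIdeal α
  exact (h1.trans h2).trans
    (le_mul_of_one_le_left (Finset.prod_nonneg fun v _ =>
      zero_le_one.trans (one_le_max_pow_mult α v)) h3)

/-- Northcott's theorem for elements of a fixed number field. -/
theorem finite_setOf_heightK_lt (X : ℝ) : {α : K | heightK K α < X}.Finite := by
  have hfin : (⋃ n ∈ Set.Icc 1 ⌈X⌉₊, (fun α : K => (n : K) * α) ⁻¹'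
      {x : K | IsIntegral ℤ x ∧ ∀ φ : K →+* ℂ, ‖φ x‖ ≤ n * X}).Finite := by
    refine (Set.finite_Icc 1 ⌈X⌉₊).biUnion fun n hn => ?_
    refine (Embeddings.finite_of_norm_le K ℂ (n * X)).preimage ?_
    refine (mul_right_injective₀ ?_).injOn
    exact Nat.cast_ne_zero.mpr (Nat.one_le_iff_ne_zero.mp hn.1)
  refine hfin.subset fun α (hα : heightK K α < X) => ?_
  simp only [Set.mem_iUnion]
  refine ⟨Ideal.absNorm (denIdeal K α), ⟨one_le_absNorm_denIdeal α, ?_⟩, ?_, ?_⟩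
  · have := (absNorm_denIdeal_le_heightK α).trans (hα.le.trans (Nat.le_ceil X))
    exact_mod_cast this
  · obtain ⟨y, hy⟩ := mem_denIdeal.mp (Ideal.absNorm_mem (denIdeal K α))
    have : ((Ideal.absNorm (denIdeal K α) : ℕ) : K) * α = y := by rw [← hy]; simp
    simpa only [this] using y.isIntegral_coe
  · rw [← InfinitePlace.le_iff_le]
    intro w
    have hn : w ((Ideal.absNorm (denIdeal K α) : ℕ) : K) = Ideal.absNorm (denIdeal K α) := by
      simp
    simp only [map_mul, hn]
    gcongr
    exact (infinitePlace_le_heightK α w).trans hα.le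

theorem heightK_natCast_mul_add_natCast_le (α : K) {a b Y : ℕ} (ha : a ≤ Y) (hb : b ≤ Y)
    (hY : 1 ≤ Y) :
    heightK K (a * α + b) ≤ (2 * Y) ^ Module.finrank ℚ K * heightK K α := by
  have hden : Ideal.absNorm (denIdeal K (a * α + b)) ≤ Ideal.absNorm (denIdeal K α) := by
    refine Nat.le_of_dvd (one_le_absNorm_denIdeal α) (Ideal.absNorm_dvd_absNorm_of_le ?_)
    rintro x ⟨y, hy⟩
    refine ⟨a * y + b * x, ?_⟩
    push_cast
    linear_combination (a : K) * hy
  have hY' : (1 : ℝ) ≤ Y := by exact_mod_cast hY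
  have ha' : (a : ℝ) ≤ Y := by exact_mod_cast ha
  have hb' : (b : ℝ) ≤ Y := by exact_mod_cast hb
  have hw (w : InfinitePlace K) :
      max 1 (w (a * α + b)) ^ w.mult ≤ (2 * Y : ℝ) ^ w.mult * max 1 (w α) ^ w.mult := by
    rw [← mul_pow]
    refine pow_le_pow_left₀ (zero_le_one.trans (le_max_left _ _)) (max_le ?_ ?_) _
    · nlinarith [le_max_left 1 (w α)]
    · have h1 : w (a * α + b) ≤ w (a * α) + w b := w.1.add_le _ _
      have h2 : w (a * α) = a * w α := by simp
      have h3 : w (b : K) = b := by simp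
      have h4 : (a : ℝ) * w α ≤ Y * max 1 (w α) := by
        gcongr
        exact le_max_right _ _
      nlinarith [le_max_left 1 (w α)]
  calc heightK K (a * α + b)
      ≤ Ideal.absNorm (denIdeal K α) *
        ∏ w : InfinitePlace K, ((2 * Y : ℝ) ^ w.mult * max 1 (w α) ^ w.mult) := by
        unfold heightK
        gcongr with w
        exact hw w
    _ = _ := by
        rw [Finset.prod_mul_distrib, Finset.prod_pow_eq_pow_sum, InfinitePlace.sum_mult_eq,
          heightK]
        ring

theorem adjoin_natCast_mul_add_natCast {α : K} (hα : IntermediateField.adjoin ℚ {α} = ⊤)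
    {a : ℕ} (ha : a ≠ 0) (b : ℕ) :
    IntermediateField.adjoin ℚ {(a * α + b : K)} = ⊤ := by
  rw [eq_top_iff, ← hα, IntermediateField.adjoin_simple_le_iff]
  have hmem := IntermediateField.mem_adjoin_simple_self ℚ (a * α + b : K)
  have h : α = (a * α + b - b) / a := by
    have : (a : K) ≠ 0 := Nat.cast_ne_zero.mpr ha
    field_simp
    ring
  have hdiv := div_mem (sub_mem hmem (natCast_mem _ b)) (natCast_mem _ a)
  rwa [← h] at hdiv

theorem natCast_mul_add_natCast_injective {α : K}
    (hα : IntermediateField.adjoin ℚ {α} = ⊤) (hd : 1 < Module.finrank ℚ K)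
    {a b a' b' : ℕ} (h : (a * α + b : K) = a' * α + b') : a = a' ∧ b = b' := by
  have haa : a = a' := by
    by_contra hne
    have hne' : (a - a' : K) ≠ 0 := sub_ne_zero.mpr (by exact_mod_cast hne)
    have hq : α = algebraMap ℚ K ((b' - b) / (a - a')) := by
      simp only [map_div₀, map_sub, map_natCast]
      rw [eq_div_iff hne']
      linear_combination h
    have hbot : IntermediateField.adjoin ℚ {α} = ⊥ :=
      IntermediateField.adjoin_simple_eq_bot_iff.mpr
        (IntermediateField.mem_bot.mpr ⟨_, hq.symm⟩)
    have h1 := IntermediateField.finrank_top' (F := ℚ) (E := K)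
    rw [← hα, hbot, IntermediateField.finrank_bot] at h1
    omega
  subst haa
  exact ⟨rfl, by exact_mod_cast add_left_cancel h⟩

theorem sq_le_NprimeK {α : K} (hα : IntermediateField.adjoin ℚ {α} = ⊤)
    (hd : 1 < Module.finrank ℚ K) {X : ℝ} {Y : ℕ}
    (hX : Y = 0 ∨ (2 * Y) ^ Module.finrank ℚ K * heightK K α < X) :
    Y ^ 2 ≤ NprimeK K X := by
  rcases Nat.eq_zero_or_pos Y with rfl | hY
  · simp
  have hX : (2 * Y) ^ Module.finrank ℚ K * heightK K α < X := hX.resolve_left hY.ne'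
  let S := {α : K // IntermediateField.adjoin ℚ {α} = ⊤ ∧ heightK K α < X}
  have : Finite S := ((finite_setOf_heightK_lt X).subset fun _ h => h.2).to_subtype
  let f : Fin Y × Fin Y → S := fun i =>
    ⟨((i.1 + 1 : ℕ) : K) * α + (i.2 : ℕ),
      adjoin_natCast_mul_add_natCast hα (Nat.succ_ne_zero _) _,
      (heightK_natCast_mul_add_natCast_le α (by omega) (by omega) hY).trans_lt hX⟩
  have hf : Function.Injective f := by
    rintro ⟨i, j⟩ ⟨i', j'⟩ h
    obtain ⟨hi, hj⟩ := natCast_mul_add_natCast_injective hα hd (congrArg Subtype.val h)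
    simp only [Prod.mk.injEq, Fin.ext_iff]
    exact ⟨Nat.succ_injective hi, hj⟩
  calc Y ^ 2 = Nat.card (Fin Y × Fin Y) := by simp [sq]
    _ ≤ NprimeK K X := Nat.card_le_card_of_injective f hf

/-- A primitive element of small height forces `M_{K,ℓ}` to be large once `[K : ℚ] ≤ 2ℓ`. -/
theorem le_MKl_of_heightK_le {α : K} (hα : IntermediateField.adjoin ℚ {α} = ⊤)
    (hd : 1 < Module.finrank ℚ K) {ℓ : ℕ} (hℓ : 0 < ℓ) (hdl : Module.finrank ℚ K ≤ 2 * ℓ)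
    {H : ℝ} (hH : 0 < H) (hαH : heightK K α ≤ H) :
    1 / 8 * H ^ (-(1 : ℝ) / ℓ) ≤ MKl K ℓ := by
  have hℓ' : (0 : ℝ) < ℓ := by exact_mod_cast hℓ
  have : Nonempty {X : ℝ // 0 < X} := ⟨⟨1, one_pos⟩⟩
  refine le_ciInf fun ⟨X, hX⟩ => ?_
  simp only
  set d := Module.finrank ℚ K
  have hex : ∃ Y : ℕ, X ≤ (2 * ((Y : ℝ) + 1)) ^ d * H := by
    obtain ⟨n, hn⟩ := exists_nat_ge (X / H)
    refine ⟨n, (div_le_iff₀ hH).mp (hn.trans ?_)⟩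
    have h1 : (1 : ℝ) ≤ 2 * ((n : ℝ) + 1) := by linarith [(Nat.cast_nonneg n : (0 : ℝ) ≤ n)]
    have h2 : 2 * ((n : ℝ) + 1) ≤ (2 * ((n : ℝ) + 1)) ^ d := le_self_pow₀ h1 (by omega)
    linarith [(Nat.cast_nonneg n : (0 : ℝ) ≤ n)]
  classical
  obtain ⟨Y, hY, hYmin⟩ : ∃ Y : ℕ, X ≤ (2 * ((Y : ℝ) + 1)) ^ d * H ∧
      (Y = 0 ∨ (2 * (Y : ℝ)) ^ d * H < X) := by
    refine ⟨Nat.find hex, Nat.find_spec hex, ?_⟩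
    rcases Nat.eq_zero_or_pos (Nat.find hex) with h | h
    · exact Or.inl h
    · right
      have := Nat.find_min hex (Nat.sub_one_lt h.ne')
      rw [not_le, Nat.cast_pred h, sub_add_cancel] at this
      exact this
  have hN : (Y : ℝ) ^ 2 ≤ NprimeK K X := by
    have := sq_le_NprimeK (X := X) hα hd (hYmin.imp_right fun h => lt_of_le_of_lt (by gcongr) h)
    exact_mod_cast this
  have hbase : (1 : ℝ) ≤ 2 * ((Y : ℝ) + 1) := by
    linarith [(Nat.cast_nonneg Y : (0 : ℝ) ≤ Y)]
  have hpow : X ^ ((1 : ℝ) / ℓ) ≤ (2 * ((Y : ℝ) + 1)) ^ 2 * H ^ ((1 : ℝ) / ℓ) := by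
    calc X ^ ((1 : ℝ) / ℓ) ≤ ((2 * ((Y : ℝ) + 1)) ^ d * H) ^ ((1 : ℝ) / ℓ) := by gcongr
      _ = (2 * ((Y : ℝ) + 1)) ^ ((d : ℝ) * (1 / ℓ)) * H ^ ((1 : ℝ) / ℓ) := by
        rw [Real.mul_rpow (by positivity) hH.le, ← Real.rpow_natCast, ← Real.rpow_mul
          (by positivity)]
      _ ≤ (2 * ((Y : ℝ) + 1)) ^ (2 : ℝ) * H ^ ((1 : ℝ) / ℓ) := by
        gcongr
        rw [mul_one_div, div_le_iff₀ hℓ']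
        exact_mod_cast hdl
      _ = _ := by norm_cast
  rw [neg_div, Real.rpow_neg hH.le, Real.rpow_neg hX.le]
  have hXp : 0 < X ^ ((1 : ℝ) / ℓ) := by positivity
  have hHp : 0 < H ^ ((1 : ℝ) / ℓ) := by positivity
  rw [← div_eq_mul_inv, inv_mul_eq_div, div_le_div_iff₀ hHp hXp]
  have h8 : (2 * ((Y : ℝ) + 1)) ^ 2 ≤ 8 * (1 + NprimeK K X) := by
    nlinarith [sq_nonneg ((Y : ℝ) - 1)]
  nlinarith

end HeightBasics

section RadicalFields

variable {K : Type*} [Field K] [NumberField K]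

theorem absNorm_span_natCast_ringOfIntegers (n : ℕ) :
    (Ideal.span {(n : 𝓞 K)}).absNorm = n ^ Module.finrank ℚ K := by
  rw [Ideal.absNorm_span_natCast, RingOfIntegers.rank]

theorem absNorm_span_of_pow_eq {x : 𝓞 K} {n : ℕ} (h : x ^ Module.finrank ℚ K = n) :
    (Ideal.span {x}).absNorm = n := by
  have hd : Module.finrank ℚ K ≠ 0 := Module.finrank_pos.ne'
  refine Nat.pow_left_injective hd ?_
  simp only
  rw [← map_pow, Ideal.span_singleton_pow, h, absNorm_span_natCast_ringOfIntegers]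

/-- A prime `p` such that `p m` is a `[K : ℚ]`-th power in `𝓞 K`, with `p ∤ m`, is totally
ramified in `K`, so its `([K : ℚ] - 1)`-th power divides the discriminant. -/
theorem pow_dvd_DK_of_pow_eq {p m : ℕ} (hp : p.Prime) (hpm : p.Coprime m) {x : 𝓞 K}
    (h : x ^ Module.finrank ℚ K = p * m) : p ^ (Module.finrank ℚ K - 1) ∣ DK K := by
  have hd : Module.finrank ℚ K ≠ 0 := Module.finrank_pos.ne'
  obtain ⟨I, hI⟩ : ∃ I : Ideal (𝓞 K),
      Ideal.span {(p : 𝓞 K)} = I ^ Module.finrank ℚ K := by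
    refine exists_eq_pow_of_mul_eq_pow (b := Ideal.span {(m : 𝓞 K)}) (c := Ideal.span {x}) ?_ ?_
    · rw [gcd_isUnit_iff_isRelPrime]
      refine IsCoprime.isRelPrime ((Ideal.isCoprime_span_singleton_iff _ _).mpr ?_)
      exact_mod_cast (Nat.isCoprime_iff_coprime.mpr hpm).map (algebraMap ℤ (𝓞 K))
    · rw [Ideal.span_singleton_mul_span_singleton, Ideal.span_singleton_pow, h]
  have hIn : I.absNorm = p := by
    refine Nat.pow_left_injective hd ?_
    simp only
    rw [← map_pow, ← hI, absNorm_span_natCast_ringOfIntegers]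
  have hpZ : Prime (p : ℤ) := Nat.prime_iff_prime_int.mp hp
  have : (Ideal.span {(p : ℤ)}).IsMaximal :=
    PrincipalIdealRing.isMaximal_of_irreducible hpZ.irreducible
  have hdvd : I ^ (Module.finrank ℚ K - 1) ∣ differentIdeal ℤ (𝓞 K) := by
    refine pow_sub_one_dvd_differentIdeal ℤ (p := Ideal.span {(p : ℤ)}) I _ ?_ ?_
    · simpa using hp.ne_zero
    · rw [Ideal.map_span, Set.image_singleton, ← hI]
      simp
  have := Ideal.absNorm_dvd_absNorm_of_le (Ideal.dvd_iff_le.mp hdvd)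
  rwa [map_pow, hIn, absNorm_differentIdeal K (𝓞 K)] at this

theorem natCast_mul_pow_of_pow_eq_div {p q d : ℕ} (hd : d ≠ 0) (hq : q ≠ 0) {α : K}
    (hα : α ^ d = p / q) :
    (q * α) ^ d = ((p * q ^ (d - 1) : ℕ) : K) := by
  obtain ⟨k, rfl⟩ := Nat.exists_eq_succ_of_ne_zero hd
  have : (q : K) ≠ 0 := Nat.cast_ne_zero.mpr hq
  rw [mul_pow, hα]
  simp only [Nat.succ_eq_add_one, Nat.add_sub_cancel]
  push_cast
  field_simp
  ring

theorem exists_ringOfIntegers_natCast_mul {p q d : ℕ} (hd : d ≠ 0) (hq : q ≠ 0) {α : K}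
    (hα : α ^ d = p / q) :
    ∃ x : 𝓞 K, (x : K) = q * α ∧ x ^ d = ((p * q ^ (d - 1) : ℕ) : 𝓞 K) := by
  have h := natCast_mul_pow_of_pow_eq_div hd hq hα
  have hint : IsIntegral ℤ ((q : K) * α) := by
    refine IsIntegral.of_pow (Nat.pos_of_ne_zero hd) ?_
    rw [h, ← map_natCast (algebraMap ℤ K)]
    exact isIntegral_algebraMap
  obtain ⟨x, hx⟩ : ∃ x : 𝓞 K, (x : K) = q * α := ⟨⟨_, hint⟩, rfl⟩
  refine ⟨x, hx, FaithfulSMul.algebraMap_injective (𝓞 K) K ?_⟩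
  rw [map_pow, map_natCast, show algebraMap (𝓞 K) K x = q * α from hx, h]

variable {p q : ℕ} {α : K}

theorem heightK_le_of_pow_eq_div (hp : p.Prime) (hq : q.Prime) (hpq : p < q)
    (hα : α ^ Module.finrank ℚ K = p / q) : heightK K α ≤ q := by
  have hd : Module.finrank ℚ K ≠ 0 := Module.finrank_pos.ne'
  have hp0 : (p : K) ≠ 0 := Nat.cast_ne_zero.mpr hp.ne_zero
  have hα0 : α ≠ 0 := by
    rintro rfl
    rw [zero_pow hd, eq_comm, div_eq_zero_iff] at hα
    exact hα.elim hp0 (Nat.cast_ne_zero.mpr hq.ne_zero)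
  have hcop : p.Coprime q := (Nat.coprime_primes hp hq).mpr hpq.ne
  have hαinv : α⁻¹ ^ Module.finrank ℚ K = q / p := by rw [inv_pow, hα, inv_div]
  obtain ⟨x, hx, -⟩ := exists_ringOfIntegers_natCast_mul hd hq.ne_zero hα
  obtain ⟨y, hy, hyd⟩ := exists_ringOfIntegers_natCast_mul hd hp.ne_zero hαinv
  have hqmem : (q : 𝓞 K) ∈ denIdeal K α := ⟨x, by rw [hx]; simp⟩
  have hymem : y ∈ denIdeal K α := ⟨p, by rw [hy, inv_mul_cancel_right₀ hα0]; simp⟩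
  have h1 : (denIdeal K α).absNorm ∣ q ^ Module.finrank ℚ K := by
    rw [← absNorm_span_natCast_ringOfIntegers]
    exact Ideal.absNorm_dvd_absNorm_of_le ((Ideal.span_singleton_le_iff_mem _).mpr hqmem)
  have h2 : (denIdeal K α).absNorm ∣ q * p ^ (Module.finrank ℚ K - 1) := by
    rw [← absNorm_span_of_pow_eq hyd]
    exact Ideal.absNorm_dvd_absNorm_of_le ((Ideal.span_singleton_le_iff_mem _).mpr hymem)
  have h3 : (denIdeal K α).absNorm ∣ q :=
    (Nat.Coprime.coprime_dvd_left h1 (hcop.symm.pow _ _)).dvd_of_dvd_mul_right h2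
  have hw (w : InfinitePlace K) : w α ≤ 1 := by
    refine (pow_le_one_iff_of_nonneg (apply_nonneg w α) hd).mp ?_
    rw [← map_pow, hα, map_div₀]
    have hq0 : (0 : ℝ) < q := by exact_mod_cast hq.pos
    have hpq' : (p : ℝ) ≤ q := by exact_mod_cast hpq.le
    simpa using (div_le_one hq0).mpr hpq'
  have hprod : ∏ w : InfinitePlace K, max 1 (w α) ^ w.mult = 1 :=
    Finset.prod_eq_one fun w _ => by rw [max_eq_left (hw w), one_pow]
  rw [heightK, hprod, mul_one]
  exact_mod_cast Nat.le_of_dvd hq.pos h3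

theorem mul_pow_le_DK_of_pow_eq_div (hp : p.Prime) (hq : q.Prime) (hpq : p < q)
    (hα : α ^ Module.finrank ℚ K = p / q) : (p * q) ^ (Module.finrank ℚ K - 1) ≤ DK K := by
  have hd : Module.finrank ℚ K ≠ 0 := Module.finrank_pos.ne'
  have hcop : p.Coprime q := (Nat.coprime_primes hp hq).mpr hpq.ne
  have hαinv : α⁻¹ ^ Module.finrank ℚ K = q / p := by rw [inv_pow, hα, inv_div]
  obtain ⟨x, -, hx⟩ := exists_ringOfIntegers_natCast_mul hd hq.ne_zero hα
  obtain ⟨y, -, hy⟩ := exists_ringOfIntegers_natCast_mul hd hp.ne_zero hαinv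
  have h1 := pow_dvd_DK_of_pow_eq hp (hcop.pow_right _) (hx.trans (Nat.cast_mul _ _))
  have h2 := pow_dvd_DK_of_pow_eq hq (hcop.symm.pow_right _) (hy.trans (Nat.cast_mul _ _))
  rw [mul_pow]
  exact Nat.le_of_dvd (Int.natAbs_pos.mpr (discr_ne_zero K))
    ((hcop.pow _ _).mul_dvd_of_dvd_of_dvd h1 h2)

end RadicalFields

theorem irreducible_X_pow_sub_C_prime_mul {d p m : ℕ} (hd : d ≠ 0) (hp : p.Prime)
    (hpm : p.Coprime m) : Irreducible (X ^ d - C ((p * m : ℕ) : ℚ)) := by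
  have hmonic : (X ^ d - C ((p * m : ℕ) : ℤ)).Monic := monic_X_pow_sub_C _ hd
  have hirr : Irreducible (X ^ d - C ((p * m : ℕ) : ℤ)) := by
    have hpZ : Prime (p : ℤ) := Nat.prime_iff_prime_int.mp hp
    refine irreducible_of_eisenstein_criterion (P := Ideal.span {(p : ℤ)})
      ((Ideal.span_singleton_prime hpZ.ne_zero).mpr hpZ) ?_ ?_ ?_ ?_ hmonic.isPrimitive
    · rw [hmonic.leadingCoeff, Ideal.mem_span_singleton]
      exact fun h => hpZ.not_isUnit (isUnit_of_dvd_one h)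
    · intro n hn
      rw [degree_X_pow_sub_C (Nat.pos_of_ne_zero hd), Nat.cast_lt] at hn
      rw [Ideal.mem_span_singleton, coeff_sub, coeff_X_pow, if_neg hn.ne, coeff_C, zero_sub,
        dvd_neg]
      split_ifs
      · exact_mod_cast Nat.dvd_mul_right p m
      · exact dvd_zero _
    · rw [degree_X_pow_sub_C (Nat.pos_of_ne_zero hd)]
      exact_mod_cast Nat.pos_of_ne_zero hd
    · rw [Ideal.span_singleton_pow, Ideal.mem_span_singleton, coeff_sub, coeff_X_pow,
        if_neg hd.symm, coeff_C_zero, zero_sub, dvd_neg]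
      intro h
      have h' : p ^ 2 ∣ p * m := by exact_mod_cast h
      rw [sq] at h'
      exact hp.one_lt.ne'
        (Nat.Coprime.eq_one_of_dvd hpm (Nat.dvd_of_mul_dvd_mul_left hp.pos h'))
  have := (hmonic.irreducible_iff_irreducible_map_fraction_map (K := ℚ)).mp hirr
  simpa using this

theorem exists_numberField_pow_eq_div {d p q : ℕ} (hd : d ≠ 0) (hp : p.Prime) (hq : q.Prime)
    (hpq : p ≠ q) :
    ∃ (K : Type) (_ : Field K) (_ : NumberField K) (α : K), Module.finrank ℚ K = d ∧
      IntermediateField.adjoin ℚ {α} = ⊤ ∧ α ^ d = p / q := by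
  have hcop : p.Coprime q := (Nat.coprime_primes hp hq).mpr hpq
  let f : ℚ[X] := X ^ d - C ((p * q ^ (d - 1) : ℕ) : ℚ)
  have hirr : Irreducible f := irreducible_X_pow_sub_C_prime_mul hd hp (hcop.pow_right _)
  have : Fact (Irreducible f) := ⟨hirr⟩
  have : FiniteDimensional ℚ (AdjoinRoot f) := (AdjoinRoot.powerBasis hirr.ne_zero).finite
  have hnf : NumberField (AdjoinRoot f) := { }
  have hq0 : (q : AdjoinRoot f) ≠ 0 := Nat.cast_ne_zero.mpr hq.ne_zero
  refine ⟨AdjoinRoot f, inferInstance, hnf, AdjoinRoot.root f / q, ?_, ?_, ?_⟩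
  · rw [(AdjoinRoot.powerBasis hirr.ne_zero).finrank, AdjoinRoot.powerBasis_dim,
      natDegree_X_pow_sub_C]
  · have htop : IntermediateField.adjoin ℚ {AdjoinRoot.root f} = ⊤ :=
      IntermediateField.adjoin_root_eq_top f
    rw [eq_top_iff, ← htop, IntermediateField.adjoin_simple_le_iff]
    have := mul_mem (IntermediateField.mem_adjoin_simple_self ℚ (AdjoinRoot.root f / q))
      (natCast_mem (IntermediateField.adjoin ℚ {AdjoinRoot.root f / (q : AdjoinRoot f)}) q)
    rwa [div_mul_cancel₀ _ hq0] at this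
  · have hroot : AdjoinRoot.root f ^ d = ((p * q ^ (d - 1) : ℕ) : AdjoinRoot f) := by
      have h := AdjoinRoot.eval₂_root f
      rw [eval₂_sub, eval₂_pow, eval₂_X, eval₂_C, map_natCast] at h
      exact sub_eq_zero.mp h
    obtain ⟨k, rfl⟩ := Nat.exists_eq_succ_of_ne_zero hd
    rw [div_pow, hroot]
    simp only [Nat.succ_eq_add_one, Nat.add_sub_cancel]
    push_cast
    field_simp
    ring

/-- For `d > 1` and `2ℓ ≥ d` there is `c > 0` (depending only on `d, ℓ`) such
that for every `B > 0` there is a number field `K` of degree `d` with `D_K > B` and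
`M_{K,ℓ} ≥ c ⬝ D_K^{-1/(2ℓ(d-1))}`. -/
theorem ellenberg_f_lower_attained (d ℓ : ℕ) (hd : 1 < d) (hℓ : 0 < ℓ) (hdl : d ≤ 2 * ℓ) :
    ∃ c : ℝ, 0 < c ∧ ∀ B : ℝ, 0 < B →
      ∃ (K : Type) (_ : Field K) (_ : NumberField K),
        Module.finrank ℚ K = d ∧ B < (DK K : ℝ) ∧
        c * (DK K : ℝ) ^ (-(1 : ℝ) / (2 * (ℓ : ℝ) * ((d : ℝ) - 1))) ≤ MKl K ℓ := by
  refine ⟨1 / 8 * 2 ^ (-(1 : ℝ) / (2 * ℓ)), by positivity, fun B _ => ?_⟩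
  obtain ⟨p, hpB, hp⟩ := Nat.exists_infinite_primes (⌈B⌉₊ + 1)
  obtain ⟨q, hq, hpq, hq2⟩ := Nat.exists_prime_lt_and_le_two_mul p hp.ne_zero
  obtain ⟨K, _, _, α, hK, hαtop, hα⟩ :=
    exists_numberField_pow_eq_div (d := d) (by omega) hp hq hpq.ne
  have hα' : α ^ Module.finrank ℚ K = p / q := by rw [hK, hα]
  have hD := mul_pow_le_DK_of_pow_eq_div hp hq hpq hα'
  rw [hK] at hD
  have hq0 : (0 : ℝ) < q := by exact_mod_cast hq.pos
  have hℓ0 : (0 : ℝ) < ℓ := by exact_mod_cast hℓ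
  have hd0 : (0 : ℝ) < (d : ℝ) - 1 := sub_pos.mpr (by exact_mod_cast hd)
  have hpD : p ≤ DK K :=
    calc p ≤ p * q := Nat.le_mul_of_pos_right p hq.pos
      _ ≤ (p * q) ^ (d - 1) := Nat.le_self_pow (by omega) _
      _ ≤ DK K := hD
  refine ⟨K, inferInstance, inferInstance, hK, ?_, ?_⟩
  · have h1 : ((⌈B⌉₊ + 1 : ℕ) : ℝ) ≤ DK K := by exact_mod_cast hpB.trans hpD
    push_cast at h1
    linarith [Nat.le_ceil B]
  · refine le_trans ?_ (le_MKl_of_heightK_le hαtop (by omega) hℓ (by omega) hq0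
      (heightK_le_of_pow_eq_div hp hq hpq hα'))
    have hDq : ((q : ℝ) ^ 2 / 2) ^ ((d : ℝ) - 1) ≤ DK K := by
      have h1 : (q : ℝ) ^ 2 / 2 ≤ p * q := by
        have : (q : ℝ) ≤ 2 * p := by exact_mod_cast hq2
        nlinarith
      have h2 : ((p : ℝ) * q) ^ (d - 1) ≤ DK K := by exact_mod_cast hD
      rw [← Nat.cast_pred (by omega), Real.rpow_natCast]
      exact (pow_le_pow_left₀ (by positivity) h1 _).trans h2
    have hexp : -(1 : ℝ) / (2 * ℓ * (d - 1)) ≤ 0 :=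
      div_nonpos_of_nonpos_of_nonneg (by norm_num) (by positivity)
    have hmain := Real.rpow_le_rpow_of_nonpos (by positivity) hDq hexp
    calc 1 / 8 * 2 ^ (-(1 : ℝ) / (2 * ℓ)) * (DK K : ℝ) ^ (-(1 : ℝ) / (2 * ℓ * (d - 1)))
        ≤ 1 / 8 * 2 ^ (-(1 : ℝ) / (2 * ℓ)) *
          (((q : ℝ) ^ 2 / 2) ^ ((d : ℝ) - 1)) ^ (-(1 : ℝ) / (2 * ℓ * (d - 1))) := by gcongr
      _ = 1 / 8 * (2 ^ (-(1 : ℝ) / (2 * ℓ)) * ((q : ℝ) ^ 2 / 2) ^ (-(1 : ℝ) / (2 * ℓ))) := by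
        rw [← Real.rpow_mul (by positivity), mul_assoc]
        congr 3
        field_simp
      _ = 1 / 8 * (q : ℝ) ^ (-(1 : ℝ) / ℓ) := by
        rw [← Real.mul_rpow (by positivity) (by positivity), mul_div_cancel₀ _ two_ne_zero,
          ← Real.rpow_natCast, ← Real.rpow_mul hq0.le]
        congr 2
        push_cast
        field_simp
end

section
/- Let ℓ be a positive integer and ε > 0. There exists a constant C = C(ε,ℓ) > 0 such that the following holds: for all coprime squarefree positive integers A_1, A_2 with a = A_1·A_2² > 1 not a perfect cube, the pure cubic field K = ℚ(a^{1/3}) satisfies #Cl_K[ℓ] ≤ C · D_K^{1/2 − 1/(3ℓ) + ε} · A_2^{1/(3ℓ)}. -/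
open NumberField Polynomial

section PrimesInResidueClass

open Filter Topology ArithmeticFunction.vonMangoldt

theorem summable_residueClass_div_rpow {q : ℕ} {a : ZMod q} {x : ℝ} (hx : 1 < x) :
    Summable fun n : ℕ ↦ residueClass a n / (n : ℝ) ^ x := by
  have h : LSeriesSummable (fun n ↦ (residueClass a n : ℂ)) (x : ℂ) :=
    LSeriesSummable_of_abscissaOfAbsConv_lt_re <|
      (abscissaOfAbsConv_residueClass_le_one a).trans_lt <| by norm_cast
  refine (h.norm).congr fun n ↦ ?_
  rcases eq_or_ne n 0 with rfl | hn
  · simp only [LSeries.term_zero, norm_zero, residueClass_apply_zero, zero_div]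
  · rw [LSeries.term_of_ne_zero hn, norm_div, Complex.norm_real, Real.norm_of_nonneg
      (residueClass_nonneg a n), Complex.norm_natCast_cpow_of_pos (Nat.pos_of_ne_zero hn),
      Complex.ofReal_re]

variable {q : ℕ} [NeZero q] {a : ZMod q}

theorem tsum_residueClass_eq (ha : IsUnit a) {x : ℝ} (hx : 1 < x) :
    ∑' n, residueClass a n / (n : ℝ) ^ x =
      (LFunctionResidueClassAux a x).re + (q.totient : ℝ)⁻¹ / (x - 1) := by
  refine Complex.ofReal_injective ?_
  simp only [Complex.ofReal_tsum, Complex.ofReal_div, Complex.ofReal_cpow (Nat.cast_nonneg _),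
    Complex.ofReal_natCast, Complex.ofReal_add, Complex.ofReal_inv, Complex.ofReal_sub,
    Complex.ofReal_one]
  simp_rw [← LFunctionResidueClassAux_real ha hx,
    eqOn_LFunctionResidueClassAux ha <| Set.mem_ofPred.mpr (Complex.ofReal_re x ▸ hx),
    sub_add_cancel, LSeries, LSeries.term]
  refine tsum_congr fun n ↦ ?_
  split_ifs with hn
  · simp only [hn, residueClass_apply_zero, Complex.ofReal_zero, zero_div]
  · rfl

theorem tendsto_mul_tsum_residueClass (ha : IsUnit a) {k : ℝ} (hk : 0 < k) :
    Tendsto (fun δ : ℝ ↦ δ * ∑' n, residueClass a n / (n : ℝ) ^ (1 + k * δ)) (𝓝[>] 0)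
      (𝓝 ((q.totient : ℝ)⁻¹ / k)) := by
  have hc : ContinuousOn (fun x : ℝ ↦ (LFunctionResidueClassAux a x).re) (Set.Ici 1) :=
    Complex.continuous_re.continuousOn.comp (t := Set.univ)
      (continuousOn_LFunctionResidueClassAux a) (fun _ _ ↦ trivial) |>.comp
      Complex.continuous_ofReal.continuousOn fun x hx ↦ by
        simpa using hx
  have hlim : Tendsto (fun δ : ℝ ↦ 1 + k * δ) (𝓝[>] 0) (𝓝[≥] 1) := by
    refine tendsto_nhdsWithin_iff.mpr ⟨?_, ?_⟩
    · have : Tendsto (fun δ : ℝ ↦ 1 + k * δ) (𝓝 0) (𝓝 (1 + k * 0)) := by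
        apply Continuous.tendsto; fun_prop
      simpa using this.mono_left nhdsWithin_le_nhds
    · filter_upwards [self_mem_nhdsWithin] with δ hδ
      have : 0 < k * δ := mul_pos hk hδ
      simp only [Set.mem_Ici]; linarith
  have h1 := (hc 1 (by simp)).tendsto.comp hlim
  have h2 : Tendsto (fun δ : ℝ ↦ δ) (𝓝[>] 0) (𝓝 0) := tendsto_id.mono_left nhdsWithin_le_nhds
  have h3 := (h2.mul h1).add_const ((q.totient : ℝ)⁻¹ / k)
  rw [zero_mul, zero_add] at h3
  refine h3.congr' ?_
  filter_upwards [self_mem_nhdsWithin] with δ hδ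
  have hδ' : (0 : ℝ) < δ := hδ
  have : 0 < k * δ := mul_pos hk hδ
  rw [tsum_residueClass_eq ha (by linarith)]
  simp only [Function.comp]
  field_simp
  ring

theorem exists_polynomial_concentrated {η : ℝ} (hη : 0 < η) (hη' : η < 1 / 2) :
    ∃ W : ℝ[X], (∀ u ∈ Set.Icc (0 : ℝ) 1, W.eval u ≤ 1) ∧
      (∀ u ∈ Set.Icc (0 : ℝ) 1, η ≤ |u - 1 / 2| → W.eval u ≤ 0) ∧
      0 < ∑ k ∈ W.support, W.coeff k / (k + 1 : ℝ) := by
  obtain ⟨N, hN⟩ : ∃ N : ℕ, ((1 - 4 * η ^ 2) / (1 - η ^ 2)) ^ N < η := by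
    refine exists_pow_lt_of_lt_one hη ?_
    rw [div_lt_one (by nlinarith)]
    nlinarith [sq_pos_of_pos hη]
  have h1 : 0 < 1 - 4 * η ^ 2 := by nlinarith
  have h2 : 0 < 1 - η ^ 2 := by nlinarith
  rw [div_pow, div_lt_iff₀ (by positivity)] at hN
  set c := (1 - 4 * η ^ 2) ^ N with hc
  set W : ℝ[X] := (C 4 * X * (1 - X)) ^ N - C c with hW
  have hev (u : ℝ) : W.eval u = (1 - 4 * (u - 1 / 2) ^ 2) ^ N - c := by
    simp [hW]; ring
  refine ⟨W, fun u hu ↦ ?_, fun u hu h ↦ ?_, ?_⟩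
  · rw [hev]
    have : (1 - 4 * (u - 1 / 2) ^ 2) ^ N ≤ 1 :=
      pow_le_one₀ (by nlinarith [hu.1, hu.2]) (by nlinarith [sq_nonneg (u - 1 / 2)])
    have : 0 < c := by positivity
    linarith
  · rw [hev, sub_nonpos]
    refine pow_le_pow_left₀ (by nlinarith [hu.1, hu.2]) ?_ N
    have : η ^ 2 ≤ (u - 1 / 2) ^ 2 := by rw [← sq_abs (u - 1 / 2)]; gcongr
    linarith
  · have hint : ∫ u in (0 : ℝ)..1, W.eval u = ∑ k ∈ W.support, W.coeff k / (k + 1 : ℝ) := by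
      simp_rw [eval_eq_sum, Polynomial.sum]
      rw [intervalIntegral.integral_finsetSum]
      · refine Finset.sum_congr rfl fun k _ ↦ ?_
        rw [intervalIntegral.integral_const_mul, integral_pow]
        simp [div_eq_mul_inv]
      · intro i _
        apply Continuous.intervalIntegrable; fun_prop
    rw [← hint]
    have hii (f : ℝ → ℝ) (hf : Continuous f) (x y : ℝ) :
        IntervalIntegrable f MeasureTheory.volume x y := hf.intervalIntegrable x y
    have hcont : Continuous fun u : ℝ ↦ (1 - 4 * (u - 1 / 2) ^ 2) ^ N := by fun_prop
    simp_rw [hev]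
    rw [intervalIntegral.integral_sub (hii _ hcont _ _) (hii _ continuous_const _ _)]
    have hlow : ∫ u in (1 / 2 - η / 2)..(1 / 2 + η / 2), (1 - 4 * (u - 1 / 2) ^ 2) ^ N ≤
        ∫ u in (0 : ℝ)..1, (1 - 4 * (u - 1 / 2) ^ 2) ^ N := by
      refine intervalIntegral.integral_mono_interval (by linarith) (by linarith) (by linarith) ?_
        (hii _ hcont _ _)
      refine (MeasureTheory.ae_restrict_iff' measurableSet_Ioc).mpr (.of_forall fun u hu ↦ ?_)
      have : 0 ≤ 1 - 4 * (u - 1 / 2) ^ 2 := by nlinarith [hu.1, hu.2]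
      simp only [Pi.zero_apply]; positivity
    have hlow2 : ∫ _ in (1 / 2 - η / 2)..(1 / 2 + η / 2), (1 - η ^ 2) ^ N ≤
        ∫ u in (1 / 2 - η / 2)..(1 / 2 + η / 2), (1 - 4 * (u - 1 / 2) ^ 2) ^ N := by
      refine intervalIntegral.integral_mono_on (by linarith) (hii _ continuous_const _ _)
        (hii _ hcont _ _) fun u hu ↦ ?_
      refine pow_le_pow_left₀ h2.le ?_ N
      nlinarith [hu.1, hu.2]
    simp only [intervalIntegral.integral_const, smul_eq_mul] at hlow2 ⊢
    nlinarith

theorem exists_le_sum_residueClass_div (ha : IsUnit a) {ε : ℝ} (hε : 0 < ε) :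
    ∃ c : ℝ, 0 < c ∧ ∃ X₀ : ℝ, ∀ X : ℝ, X₀ ≤ X →
      c * Real.log X ≤ ∑ n ∈ (Finset.range (⌊X⌋₊ + 1)).filter (fun n : ℕ ↦ X ^ (1 - ε) ≤ n),
        residueClass a n / n := by
  obtain ⟨η, hη, hη', hρ⟩ : ∃ η : ℝ, 0 < η ∧ η < 1 / 2 ∧
      (1 - ε) * Real.log (1 / 2 - η) ≥ Real.log (1 / 2 + η) := by
    have h0 : Tendsto (fun η : ℝ ↦ (1 - ε) * Real.log (1 / 2 - η) - Real.log (1 / 2 + η))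
        (𝓝[>] 0) (𝓝 ((1 - ε) * Real.log (1 / 2 - 0) - Real.log (1 / 2 + 0))) := by
      refine Tendsto.mono_left ?_ nhdsWithin_le_nhds
      refine ContinuousAt.tendsto ?_
      fun_prop (disch := norm_num)
    have hpos : 0 < (1 - ε) * Real.log (1 / 2 - 0) - Real.log (1 / 2 + 0) := by
      have : Real.log (1 / 2) < 0 := Real.log_neg (by norm_num) (by norm_num)
      rw [sub_zero, add_zero]; nlinarith
    have h1 := h0.eventually (lt_mem_nhds hpos)
    have h2 : ∀ᶠ η : ℝ in 𝓝[>] 0, η < 1 / 2 :=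
      (tendsto_id.mono_left nhdsWithin_le_nhds).eventually (gt_mem_nhds (by norm_num))
    obtain ⟨η, h1, h2, h3⟩ := (h1.and (h2.and self_mem_nhdsWithin)).exists
    exact ⟨η, h3, h2, by linarith⟩
  obtain ⟨W, hW1, hW0, hWpos⟩ := exists_polynomial_concentrated hη hη'
  set I := ∑ k ∈ W.support, W.coeff k / (k + 1 : ℝ) with hI
  have hφ : (0 : ℝ) < (q.totient : ℝ)⁻¹ := by
    have := Nat.totient_pos.mpr (NeZero.pos q)
    positivity
  have hlim : Tendsto (fun δ : ℝ ↦ ∑ k ∈ W.support, W.coeff k *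
      (δ * ∑' n, residueClass a n / (n : ℝ) ^ (1 + (k + 1 : ℝ) * δ))) (𝓝[>] 0)
      (𝓝 ((q.totient : ℝ)⁻¹ * I)) := by
    have : (q.totient : ℝ)⁻¹ * I =
        ∑ k ∈ W.support, W.coeff k * ((q.totient : ℝ)⁻¹ / (k + 1 : ℝ)) := by
      rw [hI, Finset.mul_sum]
      exact Finset.sum_congr rfl fun k _ ↦ by ring
    rw [this]
    exact tendsto_finsetSum _ fun k _ ↦
      (tendsto_mul_tsum_residueClass ha (by positivity)).const_mul _
  set α : ℝ := 1 / 2 - η with hα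
  have hα0 : 0 < α := by linarith
  have hα1 : 0 < -Real.log α := by
    have := Real.log_neg hα0 (by linarith)
    linarith
  have hδ : Tendsto (fun X : ℝ ↦ -Real.log α / Real.log X) atTop (𝓝[>] 0) := by
    refine tendsto_nhdsWithin_iff.mpr ⟨Real.tendsto_log_atTop.const_div_atTop _, ?_⟩
    filter_upwards [eventually_gt_atTop 1] with X hX
    exact div_pos hα1 (Real.log_pos hX)
  have hev := (hlim.comp hδ).eventually (lt_mem_nhds (show (q.totient : ℝ)⁻¹ * I / 2 <
    (q.totient : ℝ)⁻¹ * I from half_lt_self (by positivity)))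
  obtain ⟨X₀, hX₀⟩ := eventually_atTop.mp (hev.and (eventually_gt_atTop 1))
  refine ⟨(q.totient : ℝ)⁻¹ * I / 2 / (-Real.log α), by positivity, X₀, fun X hX ↦ ?_⟩
  obtain ⟨hmain, hX1⟩ := hX₀ X hX
  have hlogX : 0 < Real.log X := Real.log_pos hX1
  simp only [Function.comp] at hmain
  set δ : ℝ := -Real.log α / Real.log X with hδdef
  have hδ0 : 0 < δ := div_pos hα1 hlogX
  set T := (Finset.range (⌊X⌋₊ + 1)).filter (fun n : ℕ ↦ X ^ (1 - ε) ≤ n) with hT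
  have hsum (k : ℕ) : Summable fun n : ℕ ↦ residueClass a n / (n : ℝ) ^ (1 + (k + 1 : ℝ) * δ) :=
    summable_residueClass_div_rpow (by have : (0:ℝ) < (k + 1) * δ := by positivity
                                       linarith)
  have hterm (n : ℕ) : ∑ k ∈ W.support,
      W.coeff k * (residueClass a n / (n : ℝ) ^ (1 + (k + 1 : ℝ) * δ)) =
      residueClass a n / n * ((n : ℝ) ^ (-δ) * W.eval ((n : ℝ) ^ (-δ))) := by
    rcases eq_or_ne n 0 with rfl | hn
    · simp
    have hn0 : (0 : ℝ) < n := by positivity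
    rw [eval_eq_sum, Polynomial.sum, Finset.mul_sum, Finset.mul_sum]
    refine Finset.sum_congr rfl fun k _ ↦ ?_
    have : (n : ℝ) ^ (1 + (k + 1 : ℝ) * δ) = n * ((n : ℝ) ^ δ * ((n : ℝ) ^ δ) ^ k) := by
      rw [← pow_succ', ← Real.rpow_natCast, ← Real.rpow_mul hn0.le, Real.rpow_add hn0,
        Real.rpow_one]
      push_cast; ring_nf
    rw [this, Real.rpow_neg hn0.le, inv_pow]
    field_simp
  have hbound (n : ℕ) : residueClass a n / n * ((n : ℝ) ^ (-δ) * W.eval ((n : ℝ) ^ (-δ))) ≤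
      if n ∈ T then residueClass a n / n else 0 := by
    rcases eq_or_ne n 0 with rfl | hn
    · simp
    have hn0 : (0 : ℝ) < n := by positivity
    have hn1 : (1 : ℝ) ≤ n := by exact_mod_cast Nat.one_le_iff_ne_zero.mpr hn
    have hu0 : 0 < (n : ℝ) ^ (-δ) := by positivity
    have hu1 : (n : ℝ) ^ (-δ) ≤ 1 := Real.rpow_le_one_of_one_le_of_nonpos hn1 (by linarith)
    have hr : 0 ≤ residueClass a n / n := div_nonneg (residueClass_nonneg a n) hn0.le
    have hlogu : Real.log ((n : ℝ) ^ (-δ)) = Real.log α * (Real.log n / Real.log X) := by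
      rw [Real.log_rpow hn0, hδdef]; field_simp
    split_ifs with hnT
    · refine mul_le_of_le_one_right hr ?_
      have := hW1 _ ⟨hu0.le, hu1⟩
      nlinarith
    · refine mul_nonpos_of_nonneg_of_nonpos hr (mul_nonpos_of_nonneg_of_nonpos hu0.le
        (hW0 _ ⟨hu0.le, hu1⟩ ?_))
      rw [hT, Finset.mem_filter, Finset.mem_range, Nat.lt_succ_iff,
        Nat.le_floor_iff (by linarith), not_and_or, not_le, not_le] at hnT
      rcases hnT with h | h
      · have h1 : 1 < Real.log n / Real.log X := by
          rw [one_lt_div hlogX]; exact Real.log_lt_log (by linarith) h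
        have h2 : (n : ℝ) ^ (-δ) ≤ α := by
          rw [← Real.log_le_log_iff hu0 hα0, hlogu]; nlinarith
        rw [le_abs]; right; linarith
      · have h1 : Real.log n / Real.log X ≤ 1 - ε := by
          rw [div_le_iff₀ hlogX, ← Real.log_rpow (by linarith)]
          exact Real.log_le_log hn0 h.le
        have h2 : 1 / 2 + η ≤ (n : ℝ) ^ (-δ) := by
          rw [← Real.log_le_log_iff (by linarith) hu0, hlogu]; nlinarith
        rw [le_abs]; left; linarith
  have hle : ∑ k ∈ W.support, W.coeff k * (δ * ∑' n, residueClass a n /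
      (n : ℝ) ^ (1 + (k + 1 : ℝ) * δ)) ≤ δ * ∑ n ∈ T, residueClass a n / n := by
    have : ∑ k ∈ W.support, W.coeff k * (δ * ∑' n, residueClass a n /
        (n : ℝ) ^ (1 + (k + 1 : ℝ) * δ)) = δ * ∑' n : ℕ,
        residueClass a n / n * ((n : ℝ) ^ (-δ) * W.eval ((n : ℝ) ^ (-δ))) := by
      simp_rw [← hterm]
      rw [Summable.tsum_finsetSum fun k _ ↦ (hsum k).mul_left _, Finset.mul_sum]
      refine Finset.sum_congr rfl fun k _ ↦ ?_
      rw [tsum_mul_left]; ring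
    rw [this]
    refine mul_le_mul_of_nonneg_left ?_ hδ0.le
    have hfin : ∑' n : ℕ, (if n ∈ T then residueClass a n / n else 0) =
        ∑ n ∈ T, residueClass a n / n := by
      rw [tsum_eq_sum (s := T) fun n hn ↦ by simp [hn]]
      exact Finset.sum_congr rfl fun n hn ↦ by simp [hn]
    rw [← hfin]
    refine Summable.tsum_le_tsum hbound ?_ ?_
    · simp_rw [← hterm]
      exact summable_sum fun k _ ↦ (hsum k).mul_left _
    · exact summable_of_ne_finset_zero (s := T) fun n hn ↦ by simp [hn]
  have hfinal := hmain.le.trans hle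
  rw [div_mul_eq_mul_div, div_le_iff₀ hα1]
  have : δ * Real.log X = -Real.log α := by rw [hδdef]; field_simp
  calc _ ≤ δ * (∑ n ∈ T, residueClass a n / n) * Real.log X := by gcongr
    _ = _ := by rw [← this]; ring

theorem card_primePow_residueClass_le (a : ZMod 3) (ha : a = 2) (N : ℕ) :
    (((Finset.range (N + 1)).filter fun n ↦ residueClass a n ≠ 0).card) ≤
      ((Finset.range (N + 1)).filter fun p ↦ p.Prime ∧ p % 3 = 2).card * (Nat.log 2 N + 1) := by
  classical
  set S := (Finset.range (N + 1)).filter fun p ↦ p.Prime ∧ p % 3 = 2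
  have hsub : ((Finset.range (N + 1)).filter fun n ↦ residueClass a n ≠ 0) ⊆
      (S ×ˢ Finset.range (Nat.log 2 N + 1)).image fun x ↦ x.1 ^ x.2 := by
    intro n hn
    rw [Finset.mem_filter, Finset.mem_range, Nat.lt_succ_iff] at hn
    obtain ⟨hnN, hn⟩ := hn
    obtain ⟨hmem, hΛ⟩ := Set.indicator_apply_ne_zero.mp hn
    rw [Function.mem_support, ArithmeticFunction.vonMangoldt_ne_zero_iff, isPrimePow_nat_iff] at hΛ
    obtain ⟨p, k, hp, hk, rfl⟩ := hΛ
    have hmod : p ^ k % 3 = 2 := by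
      have h : ((p ^ k : ℕ) : ZMod 3) = (2 : ℕ) := by simpa [ha] using hmem
      simpa using (ZMod.natCast_eq_natCast_iff' _ _ _).mp h
    have hp3 : p % 3 = 2 := by
      have h3 : p % 3 < 3 := Nat.mod_lt _ (by norm_num)
      rw [Nat.pow_mod] at hmod
      interval_cases h : p % 3
      · simp [Nat.zero_pow hk] at hmod
      · simp at hmod
      · rfl
    have hpk : p ≤ p ^ k := Nat.le_self_pow hk.ne' p
    refine Finset.mem_image.mpr ⟨(p, k), ?_, rfl⟩
    simp only [S, Finset.mem_product, Finset.mem_filter, Finset.mem_range, Nat.lt_succ_iff]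
    refine ⟨⟨hpk.trans hnN, hp, hp3⟩, ?_⟩
    exact Nat.le_log_of_pow_le (by norm_num) ((Nat.pow_le_pow_left hp.two_le k).trans hnN)
  calc _ ≤ _ := Finset.card_le_card hsub
    _ ≤ _ := Finset.card_image_le
    _ = _ := by simp

theorem exists_rpow_le_card_primes_two_mod_three {ε : ℝ} (hε : 0 < ε) (hε' : ε < 1) :
    ∃ c : ℝ, 0 < c ∧ ∀ X : ℝ, 0 < X → c * X ^ (1 - ε) ≤
      ((Finset.range (⌊X⌋₊ + 1)).filter fun p ↦ p.Prime ∧ p % 3 = 2).card + 1 := by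
  have hunit : IsUnit (2 : ZMod 3) := by decide
  obtain ⟨c, hc, X₀, h⟩ := exists_le_sum_residueClass_div hunit (half_pos hε)
  set X₁ := max X₀ 2
  have hX₁ : 0 < X₁ := lt_of_lt_of_le two_pos (le_max_right _ _)
  set d := 1 / (ε / 2) / Real.log 2 + 1
  have hlog2 : 0 < Real.log 2 := Real.log_pos one_lt_two
  have hd : 0 < d := by positivity
  refine ⟨min (c / d) (X₁ ^ (1 - ε))⁻¹, by positivity, fun X hX ↦ ?_⟩
  have hXε : 0 < X ^ (1 - ε) := by positivity
  rcases le_total X X₁ with hle | hle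
  · calc _ ≤ (X₁ ^ (1 - ε))⁻¹ * X₁ ^ (1 - ε) := by
          gcongr
          exact min_le_right _ _
      _ = 1 := inv_mul_cancel₀ (by positivity)
      _ ≤ _ := by simp
  have hX1 : 1 < X := lt_of_lt_of_le one_lt_two ((le_max_right _ _).trans hle)
  have hlogX : 0 < Real.log X := Real.log_pos hX1
  set N := ⌊X⌋₊
  have hNX : (N : ℝ) ≤ X := Nat.floor_le hX.le
  set π := ((Finset.range (N + 1)).filter fun p ↦ p.Prime ∧ p % 3 = 2).card
  have h1 : c * X ^ (1 - ε / 2) ≤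
      ((Finset.range (N + 1)).filter fun n ↦ residueClass (2 : ZMod 3) n ≠ 0).card := by
    have hterm : ∑ n ∈ (Finset.range (N + 1)).filter (fun n : ℕ ↦ X ^ (1 - ε / 2) ≤ n),
        residueClass (2 : ZMod 3) n / n ≤
        ∑ n ∈ (Finset.range (N + 1)).filter fun n ↦ residueClass (2 : ZMod 3) n ≠ 0,
          Real.log X / X ^ (1 - ε / 2) := by
      rw [← Finset.sum_filter_ne_zero]
      refine (Finset.sum_le_sum fun n hn ↦ ?_).trans
        (Finset.sum_le_sum_of_subset_of_nonneg ?_ fun _ _ _ ↦ by positivity)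
      · simp only [Finset.mem_filter, Finset.mem_range, Nat.lt_succ_iff] at hn
        have hn0 : (0 : ℝ) < n := lt_of_lt_of_le (by positivity) hn.1.2
        have hnX : (n : ℝ) ≤ X := (Nat.cast_le.mpr hn.1.1).trans hNX
        exact div_le_div₀ hlogX.le (((residueClass_le _ n).trans
          ArithmeticFunction.vonMangoldt_le_log).trans (Real.log_le_log hn0 hnX))
          (by positivity) hn.1.2
      · intro n hn
        simp only [Finset.mem_filter] at hn ⊢
        exact ⟨hn.1.1, fun h0 ↦ hn.2 (by rw [h0, zero_div])⟩
    have h2 := (h X ((le_max_left _ _).trans hle)).trans hterm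
    rw [Finset.sum_const, nsmul_eq_mul, ← mul_div_assoc, le_div_iff₀ (by positivity)] at h2
    nlinarith
  have h2 : (((Finset.range (N + 1)).filter fun n ↦ residueClass (2 : ZMod 3) n ≠ 0).card : ℝ) ≤
      π * (Nat.log 2 N + 1) := by exact_mod_cast card_primePow_residueClass_le 2 rfl N
  have h3 : (Nat.log 2 N + 1 : ℝ) ≤ d * X ^ (ε / 2) := by
    have hN0 : N ≠ 0 := (Nat.floor_pos.mpr hX1.le).ne'
    have : (2 : ℝ) ^ Nat.log 2 N ≤ X := by
      refine le_trans ?_ hNX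
      exact_mod_cast Nat.pow_log_le_self 2 hN0
    have h4 := Real.log_le_log (by positivity) this
    rw [Real.log_pow] at h4
    have h5 := Real.log_le_rpow_div hX.le (half_pos hε)
    have h6 : (1 : ℝ) ≤ X ^ (ε / 2) := Real.one_le_rpow hX1.le (by positivity)
    have h7 : (Nat.log 2 N : ℝ) ≤ X ^ (ε / 2) / (ε / 2) / Real.log 2 := by
      rw [le_div_iff₀ hlog2]; linarith
    calc _ ≤ X ^ (ε / 2) / (ε / 2) / Real.log 2 + X ^ (ε / 2) := add_le_add h7 h6
      _ = _ := by simp only [d]; ring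
  have h8 : X ^ (1 - ε / 2) = X ^ (1 - ε) * X ^ (ε / 2) := by
    rw [← Real.rpow_add hX]; ring_nf
  have h9 : c * X ^ (1 - ε) * X ^ (ε / 2) ≤ π * d * X ^ (ε / 2) := by
    calc _ = c * X ^ (1 - ε / 2) := by rw [h8]; ring
      _ ≤ π * (Nat.log 2 N + 1) := h1.trans h2
      _ ≤ π * (d * X ^ (ε / 2)) := by gcongr
      _ = _ := by ring
  have h10 := le_of_mul_le_mul_right h9 (by positivity)
  calc _ ≤ c / d * X ^ (1 - ε) := by gcongr; exact min_le_left _ _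
    _ ≤ π := by rw [div_mul_eq_mul_div, div_le_iff₀ hd]; exact h10
    _ ≤ _ := by linarith

end PrimesInResidueClass

section IdealCounting

theorem card_le_mul_rpow_of_prod_le {n N : ℕ} {s : ℝ} (hs : 1 < s) (T : Finset (Fin n → ℕ))
    (h0 : ∀ m ∈ T, ∀ j, m j ≠ 0) (hT : ∀ m ∈ T, ∏ j, m j ≤ N) :
    (T.card : ℝ) ≤ (∑' k : ℕ, 1 / (k : ℝ) ^ s) ^ n * (N : ℝ) ^ s := by
  have hsum := Real.summable_one_div_nat_rpow.mpr hs
  have hsub : T ⊆ Fintype.piFinset fun _ : Fin n ↦ Finset.range (N + 1) := by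
    intro m hm
    rw [Fintype.mem_piFinset]
    intro j
    rw [Finset.mem_range, Nat.lt_succ_iff]
    exact (Nat.le_of_dvd (Nat.pos_of_ne_zero (Finset.prod_ne_zero_iff.mpr fun j _ ↦ h0 m hm j))
      (Finset.dvd_prod_of_mem m (Finset.mem_univ j))).trans (hT m hm)
  have hone (m) (hm : m ∈ T) : 1 ≤ (∏ j, 1 / (m j : ℝ) ^ s) * (N : ℝ) ^ s := by
    have hpos : (0 : ℝ) < ∏ j, (m j : ℝ) :=
      Finset.prod_pos fun j _ ↦ Nat.cast_pos.mpr (Nat.pos_of_ne_zero (h0 m hm j))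
    have : ∏ j, 1 / (m j : ℝ) ^ s = ((∏ j, (m j : ℝ)) ^ s)⁻¹ := by
      rw [← Real.finsetProd_rpow _ _ fun _ _ ↦ Nat.cast_nonneg _, ← Finset.prod_inv_distrib]
      simp
    rw [this, inv_mul_eq_div, one_le_div (by positivity)]
    refine Real.rpow_le_rpow hpos.le ?_ (by linarith)
    exact_mod_cast hT m hm
  calc (T.card : ℝ) = ∑ m ∈ T, (1 : ℝ) := by simp
    _ ≤ ∑ m ∈ T, (∏ j, 1 / (m j : ℝ) ^ s) * (N : ℝ) ^ s := Finset.sum_le_sum hone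
    _ ≤ ∑ m ∈ Fintype.piFinset fun _ : Fin n ↦ Finset.range (N + 1),
        (∏ j, 1 / (m j : ℝ) ^ s) * (N : ℝ) ^ s :=
      Finset.sum_le_sum_of_subset_of_nonneg hsub fun _ _ _ ↦ by positivity
    _ = (∑ k ∈ Finset.range (N + 1), 1 / (k : ℝ) ^ s) ^ n * (N : ℝ) ^ s := by
      rw [← Finset.sum_mul, ← Finset.prod_univ_sum (fun _ : Fin n ↦ Finset.range (N + 1))
        (fun _ (k : ℕ) ↦ 1 / (k : ℝ) ^ s)]
      simp
    _ ≤ _ := by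
      gcongr
      exact hsum.sum_le_tsum _ fun _ _ ↦ by positivity

variable (K : Type*) [Field K] [NumberField K]

open Ideal UniqueFactorizationMonoid

theorem exists_prime_mem_of_isPrime {P : Ideal (𝓞 K)} (hP : P.IsPrime) (h0 : P ≠ ⊥) :
    ∃ p : ℕ, p.Prime ∧ (p : 𝓞 K) ∈ P ∧ p ≤ absNorm P := by
  have hn0 : absNorm P ≠ 0 := by rwa [Ne, absNorm_eq_zero_iff]
  have hmem : ((absNorm P : ℕ) : 𝓞 K) ∈ P := absNorm_mem P
  rw [← Nat.prod_primeFactorsList hn0, Nat.cast_list_prod] at hmem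
  have : ∃ p ∈ (absNorm P).primeFactorsList, (p : 𝓞 K) ∈ P := by
    generalize (absNorm P).primeFactorsList = l at hmem
    induction l with
    | nil => simp at hmem; exact absurd ((eq_top_iff_one P).mpr hmem) hP.ne_top
    | cons a l ih =>
      rw [List.map_cons, List.prod_cons] at hmem
      rcases hP.mem_or_mem hmem with h | h
      · exact ⟨a, by simp, h⟩
      · obtain ⟨p, hp, h'⟩ := ih h
        exact ⟨p, by simp [hp], h'⟩
  obtain ⟨p, hp, hpP⟩ := this
  exact ⟨p, Nat.prime_of_mem_primeFactorsList hp, hpP, Nat.le_of_mem_primeFactorsList hp⟩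

theorem card_le_finrank_of_prime_mem {p : ℕ} (hp : p.Prime) (T : Finset (Ideal (𝓞 K)))
    (hT : ∀ P ∈ T, P.IsPrime ∧ P ≠ ⊥ ∧ (p : 𝓞 K) ∈ P ∧ p ≤ absNorm P) :
    T.card ≤ Module.finrank ℚ K := by
  have hdvd : ∏ P ∈ T, P ∣ span {(p : 𝓞 K)} := by
    refine Finset.prod_primes_dvd _ (fun P hP ↦ ?_) fun P hP ↦ ?_
    · exact prime_of_isPrime (hT P hP).2.1 (hT P hP).1
    · rw [dvd_span_singleton]; exact (hT P hP).2.2.1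
  have hle : p ^ T.card ≤ p ^ Module.finrank ℚ K := by
    calc p ^ T.card ≤ ∏ P ∈ T, absNorm P := Finset.pow_card_le_prod _ _ _ fun P hP ↦ (hT P hP).2.2.2
      _ = absNorm (∏ P ∈ T, P) := (map_prod _ _ _).symm
      _ ≤ absNorm (span {(p : 𝓞 K)}) := by
        refine Nat.le_of_dvd (Nat.pos_of_ne_zero ?_) (absNorm_dvd_absNorm_of_le (le_of_dvd hdvd))
        rw [Ne, absNorm_eq_zero_iff, span_singleton_eq_bot]
        exact_mod_cast hp.ne_zero
      _ = _ := by
        rw [absNorm_span_singleton, show ((p : ℕ) : 𝓞 K) = algebraMap ℤ (𝓞 K) p by simp,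
          Algebra.norm_algebraMap, Int.natAbs_pow, Int.natAbs_natCast, RingOfIntegers.rank]
  exact (Nat.pow_le_pow_iff_right hp.one_lt).mp hle

theorem exists_labelling_of_primes :
    ∃ (q : Ideal (𝓞 K) → ℕ) (i : Ideal (𝓞 K) → Fin (Module.finrank ℚ K)),
      (∀ P, P.IsPrime → P ≠ ⊥ → (q P).Prime ∧ q P ≤ absNorm P) ∧
      ∀ P Q, P.IsPrime → P ≠ ⊥ → Q.IsPrime → Q ≠ ⊥ → q P = q Q → i P = i Q → P = Q := by
  classical
  have hq (P : Ideal (𝓞 K)) : ∃ p : ℕ, P.IsPrime → P ≠ ⊥ →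
      p.Prime ∧ (p : 𝓞 K) ∈ P ∧ p ≤ absNorm P := by
    by_cases h : P.IsPrime ∧ P ≠ ⊥
    · obtain ⟨p, hp⟩ := exists_prime_mem_of_isPrime K h.1 h.2
      exact ⟨p, fun _ _ ↦ hp⟩
    · exact ⟨0, fun h1 h2 ↦ absurd ⟨h1, h2⟩ h⟩
  choose q hq using hq
  have hi (p : ℕ) : ∃ i : Ideal (𝓞 K) → Fin (Module.finrank ℚ K),
      Set.InjOn i {P | P.IsPrime ∧ P ≠ ⊥ ∧ q P = p} := by
    set F : Set (Ideal (𝓞 K)) := {P | P.IsPrime ∧ P ≠ ⊥ ∧ q P = p} with hF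
    have hcard (T : Finset (Ideal (𝓞 K))) (hT : (T : Set (Ideal (𝓞 K))) ⊆ F) :
        T.card ≤ Module.finrank ℚ K := by
      rcases T.eq_empty_or_nonempty with rfl | ⟨P, hP⟩
      · simp
      · have hPF := hT hP
        refine card_le_finrank_of_prime_mem K (p := p) (hPF.2.2 ▸ (hq P hPF.1 hPF.2.1).1) T
          fun Q hQ ↦ ?_
        obtain ⟨h1, h2, h3⟩ := hT hQ
        exact ⟨h1, h2, h3 ▸ (hq Q h1 h2).2⟩
    have hfin : F.Finite := by
      by_contra hinf
      obtain ⟨T, hTF, hT⟩ := Set.Infinite.exists_subset_card_eq hinf (Module.finrank ℚ K + 1)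
      have := hcard T hTF
      omega
    have := hfin.fintype
    obtain ⟨f⟩ := Function.Embedding.nonempty_of_card_le (α := F)
      (β := Fin (Module.finrank ℚ K)) (by
        rw [Fintype.card_fin, ← Set.toFinset_card]
        exact hcard _ (by simp))
    refine ⟨fun P ↦ if h : P ∈ F then f ⟨P, h⟩ else ⟨0, Module.finrank_pos⟩,
      fun P hP Q hQ hPQ ↦ ?_⟩
    simp only [hP, hQ, dif_pos] at hPQ
    exact congrArg Subtype.val (f.injective hPQ)
  choose i hi using hi
  refine ⟨q, fun P ↦ i (q P) P, fun P h1 h2 ↦ ⟨(hq P h1 h2).1, (hq P h1 h2).2.2⟩,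
    fun P Q hP hP0 hQ hQ0 hqq hii ↦ ?_⟩
  refine hi (q Q) ⟨hP, hP0, hqq⟩ ⟨hQ, hQ0, rfl⟩ ?_
  simpa only [hqq] using hii

theorem prod_fiberwise_multiset {α ι M : Type*} [Fintype ι] [DecidableEq ι] [CommMonoid M]
    (i : α → ι) (q : α → M) (s : Multiset α) :
    ∏ j, ((s.filter (i · = j)).map q).prod = (s.map q).prod := by
  induction s using Multiset.induction_on with
  | empty => simp
  | cons a s ih =>
    have (j : ι) : (((a ::ₘ s).filter (i · = j)).map q).prod =
        (if i a = j then q a else 1) * ((s.filter (i · = j)).map q).prod := by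
      by_cases h : i a = j <;> simp [h]
    simp_rw [this]
    rw [Finset.prod_mul_distrib, ih]
    simp

theorem card_ideal_absNorm_le {s : ℝ} (hs : 1 < s) (N : ℕ) (T : Finset (Ideal (𝓞 K)))
    (hT : ∀ I ∈ T, I ≠ ⊥ ∧ absNorm I ≤ N) :
    (T.card : ℝ) ≤ (∑' k : ℕ, 1 / (k : ℝ) ^ s) ^ Module.finrank ℚ K * (N : ℝ) ^ s := by
  classical
  obtain ⟨q, i, hq, hqi⟩ := exists_labelling_of_primes K
  let m (I : Ideal (𝓞 K)) (j : Fin (Module.finrank ℚ K)) : ℕ :=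
    (((normalizedFactors I).filter (i · = j)).map q).prod
  have hnf {I P : Ideal (𝓞 K)} (h : P ∈ normalizedFactors I) : P.IsPrime ∧ P ≠ ⊥ :=
    ⟨isPrime_of_prime (prime_of_normalized_factor P h), (prime_of_normalized_factor P h).ne_zero⟩
  have hm0 (I : Ideal (𝓞 K)) (j) : m I j ≠ 0 := by
    refine Multiset.prod_ne_zero fun h ↦ ?_
    obtain ⟨P, hP, h0⟩ := Multiset.mem_map.mp h
    have := hnf (Multiset.mem_filter.mp hP).1
    exact (hq P this.1 this.2).1.ne_zero h0
  have hcount (P : Ideal (𝓞 K)) (hP : P.IsPrime) (hP0 : P ≠ ⊥) (t : Multiset (Ideal (𝓞 K)))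
      (ht : ∀ Q ∈ t, Q.IsPrime ∧ Q ≠ ⊥) :
      ((t.filter (i · = i P)).map q).prod ≠ 0 ∧
      (((t.filter (i · = i P)).map q).prod).factorization (q P) = t.count P := by
    induction t using Multiset.induction_on with
    | empty => simp
    | cons Q t ih =>
      obtain ⟨ih0, ih⟩ := ih fun R hR ↦ ht R (Multiset.mem_cons_of_mem hR)
      obtain ⟨hQ, hQ0⟩ := ht Q (Multiset.mem_cons_self Q t)
      have hQp := (hq Q hQ hQ0).1
      by_cases h : i Q = i P
      · rw [Multiset.filter_cons_of_pos (p := (i · = i P)) _ h, Multiset.map_cons, Multiset.prod_cons]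
        refine ⟨mul_ne_zero hQp.ne_zero ih0, ?_⟩
        rw [Nat.factorization_mul hQp.ne_zero ih0, Finsupp.add_apply, ih,
          hQp.factorization, Multiset.count_cons]
        by_cases h' : q Q = q P
        · rw [hqi Q P hQ hQ0 hP hP0 h' h]; simp [add_comm]
        · have : P ≠ Q := fun e ↦ h' (by rw [e])
          simp [h', this]
      · rw [Multiset.filter_cons_of_neg (p := (i · = i P)) _ h]
        have : P ≠ Q := fun e ↦ h (by rw [e])
        exact ⟨ih0, by rw [ih, Multiset.count_cons_of_ne this]⟩
  have hinj : Set.InjOn m T := by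
    intro I hI J hJ hIJ
    have hI0 : I ≠ 0 := (hT I hI).1
    have hJ0 : J ≠ 0 := (hT J hJ).1
    rw [← associated_iff_eq, associated_iff_normalizedFactors_eq_normalizedFactors hI0 hJ0]
    ext P
    by_cases hP : P.IsPrime ∧ P ≠ ⊥
    · rw [← (hcount P hP.1 hP.2 _ fun Q ↦ hnf).2, ← (hcount P hP.1 hP.2 _ fun Q ↦ hnf).2]
      exact congrArg (fun x ↦ Nat.factorization x (q P)) (congrFun hIJ (i P))
    · rw [Multiset.count_eq_zero_of_notMem fun h ↦ hP (hnf h),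
        Multiset.count_eq_zero_of_notMem fun h ↦ hP (hnf h)]
  rw [← Finset.card_image_of_injOn hinj]
  refine card_le_mul_rpow_of_prod_le hs _ ?_ ?_
  · intro f hf j
    obtain ⟨I, _, rfl⟩ := Finset.mem_image.mp hf
    exact hm0 I j
  · intro f hf
    obtain ⟨I, hI, rfl⟩ := Finset.mem_image.mp hf
    calc _ = ((normalizedFactors I).map q).prod := prod_fiberwise_multiset i q _
      _ ≤ ((normalizedFactors I).map absNorm).prod :=
        Multiset.prod_map_le_prod_map₀ _ _ (fun _ _ ↦ Nat.zero_le _)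
          fun P hP ↦ (hq P (hnf hP).1 (hnf hP).2).2
      _ = absNorm I := by
        rw [← map_multiset_prod, Ideal.prod_normalizedFactors_eq_self (hT I hI).1]
      _ ≤ N := (hT I hI).2

end IdealCounting

section ClassGroupInjection

open NumberField.InfinitePlace NumberField.mixedEmbedding MeasureTheory Module
open scoped NNReal ENNReal nonZeroDivisors

variable (K : Type*) [Field K] [NumberField K]

open scoped Classical in
theorem minkowskiBound_mk0_le (J : (Ideal (𝓞 K))⁰) :
    minkowskiBound K (FractionalIdeal.mk0 K J) ≤ ENNReal.ofReal
      (2 ^ finrank ℚ K * √|(discr K : ℝ)| * Ideal.absNorm (J : Ideal (𝓞 K))) := by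
  rw [minkowskiBound, volume_fundamentalDomain_fractionalIdealLatticeBasis,
    volume_fundamentalDomain_latticeBasis, FractionalIdeal.coe_mk0,
    FractionalIdeal.coeIdeal_absNorm, mixedEmbedding.finrank, Rat.cast_natCast]
  have h1 : ((2 : ℝ≥0∞)⁻¹ ^ nrComplexPlaces K) ≤ 1 := pow_le_one' (by simp) _
  have h2 : ((NNReal.sqrt ‖discr K‖₊ : ℝ≥0) : ℝ≥0∞) = ENNReal.ofReal √|(discr K : ℝ)| := by
    rw [← ENNReal.ofReal_coe_nnreal, Real.coe_sqrt, coe_nnnorm, Int.norm_eq_abs]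
  rw [h2, ENNReal.ofReal_mul (by positivity), ENNReal.ofReal_mul (by positivity),
    ENNReal.ofReal_pow (by norm_num), ENNReal.ofReal_ofNat]
  calc _ ≤ ENNReal.ofReal (Ideal.absNorm (J : Ideal (𝓞 K)) : ℝ) *
        (1 * ENNReal.ofReal √|(discr K : ℝ)|) * 2 ^ finrank ℚ K := by gcongr
    _ = _ := by ring

theorem exists_ne_zero_mem_ideal_forall_lt {J : Ideal (𝓞 K)} (hJ : J ≠ ⊥)
    {f : InfinitePlace K → ℝ} (hf : ∀ w, 0 ≤ f w)
    (h : 2 ^ finrank ℚ K * √|(discr K : ℝ)| * Ideal.absNorm J < ∏ w, f w ^ w.mult) :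
    ∃ β ∈ J, β ≠ 0 ∧ ∀ w : InfinitePlace K, w (β : K) < f w := by
  classical
  let J' : (Ideal (𝓞 K))⁰ := ⟨J, mem_nonZeroDivisors_iff_ne_zero.mpr hJ⟩
  have key : minkowskiBound K (FractionalIdeal.mk0 K J') <
      volume (convexBodyLT K fun w ↦ (f w).toNNReal) := by
    refine (minkowskiBound_mk0_le K J').trans_lt ?_
    rw [convexBodyLT_volume]
    calc _ < ENNReal.ofReal (∏ w, f w ^ w.mult) :=
          (ENNReal.ofReal_lt_ofReal_iff_of_nonneg (by positivity)).mpr h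
      _ = ((1 : ℝ≥0) : ℝ≥0∞) * ((∏ w, (f w).toNNReal ^ w.mult : ℝ≥0) : ℝ≥0∞) := by
        rw [ENNReal.coe_one, one_mul, ENNReal.ofReal, Real.toNNReal_prod_of_nonneg
          fun w _ ↦ pow_nonneg (hf w) _]
        simp_rw [Real.toNNReal_pow (hf _)]
      _ ≤ _ := by
        gcongr
        exact_mod_cast one_le_convexBodyLTFactor K
  obtain ⟨_, ha, h0, hlt⟩ := exists_ne_zero_mem_ideal_lt K _ key
  rw [FractionalIdeal.coe_mk0] at ha
  obtain ⟨β, hβ, rfl⟩ := (FractionalIdeal.mem_coeIdeal _).mp ha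
  refine ⟨β, hβ, fun h ↦ h0 (by simp [h]), fun w ↦ ?_⟩
  simpa [Real.coe_toNNReal _ (hf w)] using hlt w

theorem absNorm_span_singleton_eq_prod (x : 𝓞 K) :
    (Ideal.absNorm (Ideal.span {x}) : ℝ) = ∏ w : InfinitePlace K, w (x : K) ^ w.mult := by
  rw [Ideal.absNorm_span_singleton, prod_eq_abs_norm, ← Algebra.coe_norm_int, Nat.cast_natAbs]
  push_cast
  rfl

theorem exists_ideal_pow_eq_span {ℓ : ℕ} (hℓ : 0 < ℓ) {c : ClassGroup (𝓞 K)} (hc : c ^ ℓ = 1)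
    {P : Ideal (𝓞 K)} (hP : P ≠ ⊥) {M : ℝ} (hM : 2 ^ finrank ℚ K * √|(discr K : ℝ)| < M) :
    ∃ (A : (Ideal (𝓞 K))⁰) (δ : 𝓞 K), (Ideal.absNorm (A : Ideal (𝓞 K)) : ℝ) ≤ M ∧
      c * ClassGroup.mk0 ⟨P, mem_nonZeroDivisors_iff_ne_zero.mpr hP⟩ * ClassGroup.mk0 A = 1 ∧
      Ideal.span {δ} = ((A : Ideal (𝓞 K)) * P) ^ ℓ ∧ ∀ w : InfinitePlace K,
        w (δ : K) ≤ (M * Ideal.absNorm P) ^ ((ℓ : ℝ) / finrank ℚ K) := by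
  obtain ⟨⟨I, hI⟩, rfl⟩ := ClassGroup.mk0_surjective c
  have hI0 : I ≠ ⊥ := mem_nonZeroDivisors_iff_ne_zero.mp hI
  rw [← map_pow, SubmonoidClass.mk_pow, ClassGroup.mk0_eq_one_iff] at hc
  obtain ⟨γ, hγ⟩ := hc
  rw [← Ideal.span] at hγ
  have hγ0 : γ ≠ 0 := by
    rintro rfl
    rw [Ideal.span_singleton_zero] at hγ
    exact pow_ne_zero ℓ hI0 hγ
  have hγK : (γ : K) ≠ 0 := by simpa using hγ0
  have hℓ' : (ℓ : ℝ) ≠ 0 := by positivity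
  have hn : (finrank ℚ K : ℝ) ≠ 0 := Nat.cast_ne_zero.mpr finrank_pos.ne'
  have hM0 : 0 < M := lt_of_le_of_lt (by positivity) hM
  have hIP0 : 0 < Ideal.absNorm (I * P) := by
    rw [Nat.pos_iff_ne_zero, Ne, Ideal.absNorm_eq_zero_iff]
    exact mul_ne_zero hI0 hP
  have hNP : 0 < M * Ideal.absNorm P := by
    refine mul_pos hM0 (Nat.cast_pos.mpr (Nat.pos_of_ne_zero ?_))
    rwa [Ne, Ideal.absNorm_eq_zero_iff]
  have hγw (w : InfinitePlace K) : 0 < w (γ : K) := w.pos_iff.mpr hγK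
  let f (w : InfinitePlace K) : ℝ :=
    w (γ : K) ^ ((1 : ℝ) / ℓ) * (M * Ideal.absNorm P) ^ ((1 : ℝ) / finrank ℚ K)
  have hf (w) : 0 ≤ f w := by have := hγw w; positivity
  have hprod : ∏ w, f w ^ w.mult = M * Ideal.absNorm (I * P) := by
    have h1 : ∏ w : InfinitePlace K, (w (γ : K) ^ ((1 : ℝ) / ℓ)) ^ w.mult = Ideal.absNorm I := by
      simp_rw [← Real.rpow_mul_natCast (hγw _).le, mul_comm ((1 : ℝ) / ℓ),
        Real.rpow_mul (hγw _).le, Real.rpow_natCast]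
      rw [Real.finsetProd_rpow _ _ fun w _ ↦ pow_nonneg (hγw w).le _,
        ← absNorm_span_singleton_eq_prod, ← hγ, map_pow, Nat.cast_pow, ← Real.rpow_natCast,
        ← Real.rpow_mul (by positivity), mul_one_div_cancel hℓ', Real.rpow_one]
    simp only [f, mul_pow]
    rw [Finset.prod_mul_distrib, h1, Finset.prod_pow_eq_pow_sum, sum_mult_eq,
      ← Real.rpow_mul_natCast hNP.le, one_div_mul_cancel hn, Real.rpow_one, map_mul]
    push_cast
    ring
  obtain ⟨β, hβ, hβ0, hβw⟩ := exists_ne_zero_mem_ideal_forall_lt K (mul_ne_zero hI0 hP) hf (by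
    rw [hprod]; gcongr)
  obtain ⟨A, hA⟩ := Ideal.dvd_span_singleton.mpr hβ
  have hβs : Ideal.span {β} ≠ (0 : Ideal (𝓞 K)) := by
    rwa [Ne, Ideal.zero_eq_bot, Ideal.span_singleton_eq_bot]
  have hA0 : A ≠ 0 := by rintro rfl; exact hβs (by rw [hA, mul_zero])
  obtain ⟨δ, hδ⟩ : γ ∣ β ^ ℓ := by
    rw [← Ideal.mem_span_singleton, ← hγ]
    exact Ideal.pow_mem_pow (Ideal.mul_le_left hβ) ℓ
  refine ⟨⟨A, mem_nonZeroDivisors_iff_ne_zero.mpr hA0⟩, δ, ?_, ?_, ?_, fun w ↦ ?_⟩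
  · have h1 : (Ideal.absNorm (I * P) : ℝ) * Ideal.absNorm A ≤ Ideal.absNorm (I * P) * M := by
      rw [← Nat.cast_mul, ← map_mul, ← hA, absNorm_span_singleton_eq_prod, mul_comm, ← hprod]
      exact Finset.prod_le_prod (fun w _ ↦ by positivity)
        fun w _ ↦ pow_le_pow_left₀ (apply_nonneg _ _) (hβw w).le _
    exact le_of_mul_le_mul_left h1 (by exact_mod_cast hIP0)
  · rw [← map_mul, ← map_mul, MulMemClass.mk_mul_mk, MulMemClass.mk_mul_mk,
      ClassGroup.mk0_eq_one_iff, ← hA]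
    exact ⟨β, rfl⟩
  · have : Ideal.span {γ} * Ideal.span {δ} = Ideal.span {γ} * (A * P) ^ ℓ := by
      rw [Ideal.span_singleton_mul_span_singleton, ← hδ, ← Ideal.span_singleton_pow, hA, ← hγ]
      ring
    refine mul_left_cancel₀ ?_ this
    rwa [Ne, Ideal.zero_eq_bot, Ideal.span_singleton_eq_bot]
  · have h1 : w (γ : K) * w (δ : K) = w (β : K) ^ ℓ := by
      rw [← map_mul, ← map_pow]; congr 1; exact_mod_cast hδ.symm
    have h2 : w (γ : K) * (M * Ideal.absNorm P) ^ ((ℓ : ℝ) / finrank ℚ K) = f w ^ ℓ := by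
      simp only [f]
      rw [mul_pow, ← Real.rpow_mul_natCast (hγw w).le, ← Real.rpow_mul_natCast hNP.le,
        one_div_mul_cancel hℓ', Real.rpow_one, one_div_mul_eq_div]
    refine le_of_mul_le_mul_left ?_ (hγw w)
    rw [h1, h2]
    exact pow_le_pow_left₀ (apply_nonneg _ _) (hβw w).le _

theorem inv_pow_le_infinitePlace_apply {δ : 𝓞 K} (hδ : δ ≠ 0) {U : ℝ} (hU : 1 ≤ U)
    (h : ∀ w : InfinitePlace K, w (δ : K) ≤ U) (w : InfinitePlace K) :
    (U ^ finrank ℚ K)⁻¹ ≤ w (δ : K) := by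
  classical
  have hU0 : 0 < U := by linarith
  have hone : (1 : ℝ) ≤ ∏ v : InfinitePlace K, v (δ : K) ^ v.mult := by
    rw [← absNorm_span_singleton_eq_prod]
    exact_mod_cast Nat.pos_of_ne_zero (by simpa [Ideal.absNorm_eq_zero_iff] using hδ)
  have hle (v : InfinitePlace K) : v (δ : K) / U ≤ 1 := (div_le_one hU0).mpr (h v)
  have hnn (v : InfinitePlace K) : 0 ≤ v (δ : K) / U := by positivity
  calc (U ^ finrank ℚ K)⁻¹ ≤ (∏ v : InfinitePlace K, v (δ : K) ^ v.mult) / U ^ finrank ℚ K := by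
        rw [inv_eq_one_div]; gcongr
    _ = ∏ v : InfinitePlace K, (v (δ : K) / U) ^ v.mult := by
        simp_rw [div_pow]
        rw [Finset.prod_div_distrib, Finset.prod_pow_eq_pow_sum, sum_mult_eq]
    _ = (w (δ : K) / U) ^ w.mult *
        ∏ v ∈ Finset.univ.erase w, (v (δ : K) / U) ^ v.mult :=
        (Finset.mul_prod_erase _ _ (Finset.mem_univ w)).symm
    _ ≤ (w (δ : K) / U) ^ w.mult * 1 := by
        gcongr
        exact Finset.prod_le_one (fun v _ ↦ pow_nonneg (hnn v) _)
          fun v _ ↦ pow_le_one₀ (hnn v) (hle v)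
    _ ≤ w (δ : K) / U := by
        rw [mul_one]
        exact pow_le_of_le_one (hnn w) (hle w) mult_pos.ne'
    _ ≤ w (δ : K) := div_le_self (apply_nonneg _ _) hU

theorem card_torsion_mul_card_le {ℓ : ℕ} (hℓ : 0 < ℓ) {ι : Type*} (S : Finset ι)
    (P : ι → Ideal (𝓞 K)) (hP : ∀ i ∈ S, P i ≠ ⊥) {M R : ℝ}
    (hM : 2 ^ finrank ℚ K * √|(discr K : ℝ)| < M) (hR : ∀ i ∈ S, (Ideal.absNorm (P i) : ℝ) ≤ R)
    {L : ℕ} (hL : (M * R) ^ ((ℓ : ℝ) / finrank ℚ K) ≤ 2 ^ L)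
    (hsep : ∀ i ∈ S, ∀ j ∈ S, i ≠ j → ∀ A : Ideal (𝓞 K), A ≠ ⊥ → ∀ δ δ' : 𝓞 K,
      Ideal.span {δ} = (A * P i) ^ ℓ → Ideal.span {δ'} = (A * P j) ^ ℓ →
      ¬ ∀ w : InfinitePlace K, w (δ : K) ≤ 2 * w (δ' : K))
    (T : Finset (Ideal (𝓞 K)))
    (hT : ∀ A : Ideal (𝓞 K), A ≠ ⊥ → (Ideal.absNorm A : ℝ) ≤ M → A ∈ T) :
    Nat.card {c : ClassGroup (𝓞 K) // c ^ ℓ = 1} * S.card ≤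
      T.card * ((finrank ℚ K + 1) * L + 1) ^ finrank ℚ K := by
  classical
  let C := {c : ClassGroup (𝓞 K) // c ^ ℓ = 1}
  choose A δ hAM hcl hsp hw using fun x : C × S ↦
    exists_ideal_pow_eq_span K hℓ x.1.2 (hP x.2 x.2.2) hM
  have hM0 : 0 < M := lt_of_le_of_lt (by positivity) hM
  have hA0 (x) : (A x : Ideal (𝓞 K)) ≠ ⊥ := mem_nonZeroDivisors_iff_ne_zero.mp (A x).2
  have hδ0 (x) : δ x ≠ 0 := by
    intro h
    have := hsp x
    rw [h, Ideal.span_singleton_zero] at this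
    exact pow_ne_zero ℓ (mul_ne_zero (hA0 x) (hP x.2 x.2.2)) this.symm
  have hwL (x) (w : InfinitePlace K) : w (δ x : K) ≤ 2 ^ L := by
    refine (hw x w).trans (le_trans ?_ hL)
    have := hR x.2 x.2.2
    gcongr
  have hwL' (x) (w : InfinitePlace K) := inv_pow_le_infinitePlace_apply K (hδ0 x)
    (one_le_pow₀ one_le_two) (hwL x) w
  have hwpos (x) (w : InfinitePlace K) : 0 < w (δ x : K) := w.pos_iff.mpr (by simpa using hδ0 x)
  let Z := Finset.Icc (-(finrank ℚ K * L : ℤ)) L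
  have hlog (x) (w : InfinitePlace K) : Int.log 2 (w (δ x : K)) ∈ Z := by
    have h2 : ((2 : ℕ) : ℝ) = 2 := by norm_num
    rw [Finset.mem_Icc, ← Int.zpow_le_iff_le_log one_lt_two (hwpos x w)]
    constructor
    · refine le_of_eq_of_le ?_ (hwL' x w)
      rw [h2, zpow_neg, ← pow_mul, mul_comm L]
      norm_cast
    · have := Int.log_mono_right (b := 2) (hwpos x w) (hwL x w)
      rwa [← h2, ← zpow_natCast, Int.log_zpow one_lt_two] at this
  let Φ (x : C × S) : T × (InfinitePlace K → Z) :=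
    (⟨A x, hT _ (hA0 x) (hAM x)⟩, fun w ↦ ⟨Int.log 2 (w (δ x : K)), hlog x w⟩)
  have hΦ : Function.Injective Φ := by
    intro x y hxy
    have hA : (A x : Ideal (𝓞 K)) = A y := congrArg (fun t ↦ ((t.1 : T) : Ideal (𝓞 K))) hxy
    have hlg (w : InfinitePlace K) : Int.log 2 (w (δ x : K)) = Int.log 2 (w (δ y : K)) :=
      congrArg (fun t ↦ ((t.2 w : Z) : ℤ)) hxy
    have h2 : x.2 = y.2 := by
      by_contra hne
      refine hsep x.2 x.2.2 y.2 y.2.2 (fun h ↦ hne (Subtype.ext h)) (A y) (hA0 y) (δ x) (δ y)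
        (hA ▸ hsp x) (hsp y) fun w ↦ ?_
      have h1 := Int.lt_zpow_succ_log_self one_lt_two (w (δ x : K))
      have h2 := Int.zpow_log_le_self one_lt_two (hwpos y w)
      rw [hlg, zpow_add_one₀ (by norm_num)] at h1
      push_cast at h1 h2
      linarith
    have h1 : x.1 = y.1 := by
      obtain ⟨cx, ix⟩ := x
      obtain ⟨cy, iy⟩ := y
      obtain rfl : ix = iy := h2
      have h := (hcl (cx, ix)).trans (hcl (cy, ix)).symm
      rw [Subtype.ext hA, mul_left_inj, mul_left_inj] at h
      exact Subtype.ext h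
    exact Prod.ext h1 h2
  have hcard := Nat.card_le_card_of_injective Φ hΦ
  have hZ : Z.card = (finrank ℚ K + 1) * L + 1 := by
    rw [Int.card_Icc]
    have : ((L : ℤ) + 1 - -(finrank ℚ K * L)) = (((finrank ℚ K + 1) * L + 1 : ℕ) : ℤ) := by
      push_cast; ring
    rw [this, Int.toNat_natCast]
  rw [Nat.card_prod, Nat.card_prod, Nat.card_fun, Nat.card_eq_fintype_card (α := S),
    Nat.card_eq_fintype_card (α := T), Nat.card_eq_fintype_card (α := Z)] at hcard
  refine (by simpa [C] using hcard : _ ≤ T.card * Z.card ^ Fintype.card (InfinitePlace K)).trans ?_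
  rw [hZ]
  gcongr
  · omega
  · rw [← sum_mult_eq, ← Finset.card_univ, Finset.card_eq_sum_ones]
    exact Finset.sum_le_sum fun w _ ↦ mult_pos

end ClassGroupInjection

section PureCubic

open Module

variable {K : Type*} [Field K] [NumberField K]

theorem squarefree_dvd_trace_of_dvd_pow {n : ℕ} (hn : Squarefree n) {x : 𝓞 K} {k : ℕ}
    (h : (n : 𝓞 K) ∣ x ^ k) : (n : ℤ) ∣ Algebra.trace ℤ (𝓞 K) x := by
  classical
  obtain ⟨y, hy⟩ := h
  have : IsReduced (ZMod n) := isReduced_zmod.mpr (Or.inl hn)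
  let b := RingOfIntegers.basis K
  let F := (Int.castRingHom (ZMod n)).mapMatrix.comp
    (Algebra.leftMulMatrix b).toRingHom
  have hnil : IsNilpotent (F x) := by
    refine ⟨k, ?_⟩
    rw [← map_pow, hy, map_mul, map_natCast, ← Matrix.diagonal_natCast, ZMod.natCast_self]
    simp
  have h0 := (Matrix.isNilpotent_trace_of_isNilpotent hnil).eq_zero
  rw [← ZMod.intCast_zmod_eq_zero_iff_dvd, Algebra.trace_eq_matrix_trace b, ← h0]
  exact AddMonoidHom.map_trace (Int.castAddHom (ZMod n)) _

theorem dvd_trace_of_mem_span {R : Type*} [CommRing R] {p : ℕ} {x : R} (hx : x ∈ Ideal.span {(p : R)}) :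
    (p : ℤ) ∣ Algebra.trace ℤ (R) x := by
  obtain ⟨y, rfl⟩ := Ideal.mem_span_singleton.mp hx
  refine ⟨Algebra.trace ℤ (R) y, ?_⟩
  rw [← Int.cast_natCast, ← zsmul_eq_mul, map_zsmul, smul_eq_mul]

/-- `α` and `β` are the two integral elements attached to the cube root of `A₁ * A₂ ^ 2`, namely
`α ^ 3 = A₁ * A₂ ^ 2` and `β ^ 3 = A₁ ^ 2 * A₂`, in a cubic field `K`. -/
structure IsPureCubicPair (A₁ A₂ : ℕ) (α β : 𝓞 K) : Prop where
  pos₁ : 0 < A₁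
  pos₂ : 0 < A₂
  squarefree : Squarefree (A₁ * A₂)
  mul_self_left : α * α = A₂ * β
  mul_self_right : β * β = A₁ * α
  mul_eq : α * β = A₁ * A₂
  trace_left : Algebra.trace ℤ (𝓞 K) α = 0
  trace_right : Algebra.trace ℤ (𝓞 K) β = 0
  finrank_eq : finrank ℚ K = 3

namespace IsPureCubicPair

variable {A₁ A₂ : ℕ} {α β : 𝓞 K}

theorem trace_add_mul_add_mul (h : IsPureCubicPair A₁ A₂ α β) (x y z : ℤ) :
    Algebra.trace ℤ (𝓞 K) (x + y * α + z * β) = 3 * x := by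
  have h1 : Algebra.trace ℤ (𝓞 K) (x : 𝓞 K) = 3 * x := by
    rw [← eq_intCast (algebraMap ℤ (𝓞 K)), Algebra.trace_algebraMap, RingOfIntegers.rank,
      h.finrank_eq]
    simp
  rw [map_add, map_add, h1, ← zsmul_eq_mul, ← zsmul_eq_mul, map_zsmul, map_zsmul, h.trace_left,
    h.trace_right]
  simp

theorem cube_left (h : IsPureCubicPair A₁ A₂ α β) : α ^ 3 = A₁ * A₂ ^ 2 := by
  linear_combination α * h.mul_self_left + (A₂ : 𝓞 K) * h.mul_eq

theorem cube_right (h : IsPureCubicPair A₁ A₂ α β) : β ^ 3 = A₁ ^ 2 * A₂ := by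
  linear_combination β * h.mul_self_right + (A₁ : 𝓞 K) * h.mul_eq

theorem discr_eq (h : IsPureCubicPair A₁ A₂ α β) :
    Algebra.discr ℤ ![1, α, β] = -27 * (A₁ * A₂) ^ 2 := by
  have t1 : Algebra.trace ℤ (𝓞 K) 1 = 3 := by simpa using h.trace_add_mul_add_mul 1 0 0
  have t2 : Algebra.trace ℤ (𝓞 K) (α * α) = 0 := by
    rw [h.mul_self_left]; simpa using h.trace_add_mul_add_mul 0 0 A₂
  have t3 : Algebra.trace ℤ (𝓞 K) (β * β) = 0 := by
    rw [h.mul_self_right]; simpa using h.trace_add_mul_add_mul 0 A₁ 0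
  have t4 : Algebra.trace ℤ (𝓞 K) (α * β) = 3 * (A₁ * A₂) := by
    rw [h.mul_eq]; simpa using h.trace_add_mul_add_mul (A₁ * A₂) 0 0
  rw [Algebra.discr_def, Matrix.det_fin_three]
  simp only [Algebra.traceMatrix_apply, Algebra.traceForm_apply, Matrix.cons_val_zero,
    Matrix.cons_val_one, Matrix.cons_val, mul_one, one_mul, mul_comm β α, t1, t2, t3, t4,
    h.trace_left, h.trace_right]
  ring

theorem exists_basis_matrix (h : IsPureCubicPair A₁ A₂ α β) :
    ∃ (ω : Basis (Fin 3) ℤ (𝓞 K)) (P : Matrix (Fin 3) (Fin 3) ℤ),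
    ![1, α, β] = Matrix.vecMul ω (P.map (algebraMap ℤ (𝓞 K))) := by
  have hcard : Fintype.card (Free.ChooseBasisIndex ℤ (𝓞 K)) = Fintype.card (Fin 3) := by
    rw [← finrank_eq_card_chooseBasisIndex, RingOfIntegers.rank, h.finrank_eq, Fintype.card_fin]
  let ω := (RingOfIntegers.basis K).reindex (Fintype.equivOfCardEq hcard)
  refine ⟨ω, ω.toMatrix ![1, α, β], ?_⟩
  rw [Basis.toMatrix_map_vecMul]

theorem exists_three_mul_eq (h : IsPureCubicPair A₁ A₂ α β)
    (γ : 𝓞 K) : ∃ x y z : ℤ, 3 * γ = x + y * α + z * β := by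
  obtain ⟨ω, P, hP⟩ := h.exists_basis_matrix
  have hT : (A₁ * A₂ : ℤ) ≠ 0 := by
    exact_mod_cast (Nat.mul_pos h.pos₁ h.pos₂).ne'
  have hm : P.det ≠ 0 := by
    intro h0
    have h1 := Algebra.discr_of_matrix_vecMul (ω : Fin 3 → 𝓞 K) P
    rw [← hP, h.discr_eq, h0] at h1
    have : (A₁ * A₂ : ℤ) ^ 2 = 0 := by linarith
    exact hT (by simpa using this)
  obtain ⟨m, hd⟩ : ∃ m, P.det = m := ⟨_, rfl⟩
  rw [hd] at hm
  obtain ⟨u, hu⟩ : ∃ u : Fin 3 → ℤ, (m : 𝓞 K) * γ = u 0 + u 1 * α + u 2 * β := by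
    have hadj : Matrix.vecMul ![1, α, β] (P.adjugate.map (algebraMap ℤ (𝓞 K))) =
        (m : 𝓞 K) • (ω : Fin 3 → 𝓞 K) := by
      rw [hP, Matrix.vecMul_vecMul, ← Matrix.map_mul, Matrix.mul_adjugate, hd,
        Matrix.smul_one_eq_diagonal, Matrix.diagonal_map (map_zero _)]
      ext i
      simp [Matrix.vecMul_diagonal, mul_comm]
    refine ⟨P.adjugate.mulVec (ω.repr γ), ?_⟩
    calc (m : 𝓞 K) * γ = ((m : 𝓞 K) • (ω : Fin 3 → 𝓞 K)) ⬝ᵥ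
          fun i ↦ ((ω.repr γ i : ℤ) : 𝓞 K) := by
          conv_lhs => rw [← ω.sum_repr γ]
          simp only [dotProduct, Finset.mul_sum, Pi.smul_apply, smul_eq_mul, zsmul_eq_mul]
          exact Finset.sum_congr rfl fun i _ ↦ by ring
      _ = _ := by
          rw [← hadj]
          simp [dotProduct, Matrix.vecMul, Matrix.mulVec, Fin.sum_univ_three]
          ring
  obtain ⟨y, hy⟩ : (A₁ * A₂ : ℤ) ∣ Algebra.trace ℤ (𝓞 K) (γ * β) := by
    rw [← Nat.cast_mul]
    refine squarefree_dvd_trace_of_dvd_pow h.squarefree (k := 3) ⟨γ ^ 3 * A₁, ?_⟩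
    rw [mul_pow, h.cube_right]; push_cast; ring
  obtain ⟨z, hz⟩ : (A₁ * A₂ : ℤ) ∣ Algebra.trace ℤ (𝓞 K) (γ * α) := by
    rw [← Nat.cast_mul]
    refine squarefree_dvd_trace_of_dvd_pow h.squarefree (k := 3) ⟨γ ^ 3 * A₂, ?_⟩
    rw [mul_pow, h.cube_left]; push_cast; ring
  have trm (x : 𝓞 K) : Algebra.trace ℤ (𝓞 K) (m * x) = m * Algebra.trace ℤ (𝓞 K) x := by
    rw [← zsmul_eq_mul, map_zsmul, smul_eq_mul]
  have e0 : m * Algebra.trace ℤ (𝓞 K) γ = 3 * u 0 := by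
    rw [← trm, hu, h.trace_add_mul_add_mul]
  have e1 : m * y = 3 * u 1 := by
    have : (m : 𝓞 K) * (γ * β) =
        (u 1 * (A₁ * A₂) : ℤ) + (u 2 * A₁ : ℤ) * α + (u 0 : ℤ) * β := by
      push_cast
      linear_combination β * hu + (u 1 : 𝓞 K) * h.mul_eq + (u 2 : 𝓞 K) * h.mul_self_right
    have := congrArg (Algebra.trace ℤ (𝓞 K)) this
    rw [trm, h.trace_add_mul_add_mul, hy] at this
    refine mul_left_cancel₀ hT ?_
    linarith
  have e2 : m * z = 3 * u 2 := by
    have : (m : 𝓞 K) * (γ * α) =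
        (u 2 * (A₁ * A₂) : ℤ) + (u 0 : ℤ) * α + (u 1 * A₂ : ℤ) * β := by
      push_cast
      linear_combination α * hu + (u 2 : 𝓞 K) * h.mul_eq + (u 1 : 𝓞 K) * h.mul_self_left
    have := congrArg (Algebra.trace ℤ (𝓞 K)) this
    rw [trm, h.trace_add_mul_add_mul, hz] at this
    refine mul_left_cancel₀ hT ?_
    linarith
  refine ⟨Algebra.trace ℤ (𝓞 K) γ, y, z, ?_⟩
  have hm' : (m : 𝓞 K) ≠ 0 := by exact_mod_cast hm
  refine mul_left_cancel₀ hm' ?_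
  have c0 : (m : 𝓞 K) * (Algebra.trace ℤ (𝓞 K) γ : ℤ) = 3 * u 0 := by exact_mod_cast e0
  have c1 : (m : 𝓞 K) * y = 3 * u 1 := by exact_mod_cast e1
  have c2 : (m : 𝓞 K) * z = 3 * u 2 := by exact_mod_cast e2
  linear_combination 3 * hu - c0 - α * c1 - β * c2

theorem natAbs_discr_bounds (h : IsPureCubicPair A₁ A₂ α β) :
    (A₁ * A₂) ^ 2 ≤ 27 * (discr K).natAbs ∧ (discr K).natAbs ≤ 27 * (A₁ * A₂) ^ 2 := by
  obtain ⟨ω, P, hP⟩ := h.exists_basis_matrix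
  choose x y z hxyz using fun i ↦ h.exists_three_mul_eq (ω i)
  let Q : Matrix (Fin 3) (Fin 3) ℤ := Matrix.of ![x, y, z]
  have hQ : Matrix.vecMul ![1, α, β] (Q.map (algebraMap ℤ (𝓞 K))) =
      Matrix.vecMul ω ((3 : Matrix (Fin 3) (Fin 3) ℤ).map (algebraMap ℤ (𝓞 K))) := by
    ext1 i
    have h3 : (3 : Matrix (Fin 3) (Fin 3) ℤ) = Matrix.diagonal fun _ ↦ 3 := rfl
    rw [h3, Matrix.diagonal_map (map_zero _)]
    simp only [Matrix.vecMul_diagonal]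
    simp [Matrix.vecMul, dotProduct, Fin.sum_univ_three, Q]
    linear_combination -hxyz i
  have d1 := Algebra.discr_of_matrix_vecMul (ω : Fin 3 → 𝓞 K) P
  have d2 := Algebra.discr_of_matrix_vecMul ![1, α, β] Q
  rw [hQ, Algebra.discr_of_matrix_vecMul] at d2
  rw [← hP] at d1
  have h3 : (3 : Matrix (Fin 3) (Fin 3) ℤ).det = 27 := by decide
  rw [discr_eq_discr, h.discr_eq] at d1 d2
  rw [h3] at d2
  have hT : 0 < (A₁ * A₂ : ℤ) ^ 2 := by
    have := h.pos₁
    have := h.pos₂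
    positivity
  have hP2 : 1 ≤ P.det ^ 2 := by
    by_contra hlt
    have : P.det ^ 2 = 0 := by nlinarith [sq_nonneg P.det]
    rw [this] at d1; linarith
  have hD := discr_ne_zero K
  have hQ2 : 1 ≤ Q.det ^ 2 := by
    by_contra hlt
    have : Q.det ^ 2 = 0 := by nlinarith [sq_nonneg Q.det]
    rw [this] at d2; apply hD; linarith
  have hneg : discr K < 0 := by
    by_contra hlt
    nlinarith [mul_nonneg (sq_nonneg P.det) (not_lt.mp hlt)]
  constructor <;> zify <;> rw [abs_of_neg hneg] <;> nlinarith

theorem exists_three_mul_eq_of_lt (h : IsPureCubicPair A₁ A₂ α β) {γ : 𝓞 K} {B : ℝ}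
    (hB : ∀ w : InfinitePlace K, w (γ : K) ≤ B) (hlt : 27 * B ^ 3 < A₁ ^ 2 * A₂) :
    ∃ x y : ℤ, 3 * γ = x + y * α := by
  obtain ⟨x, y, z, hxyz⟩ := h.exists_three_mul_eq γ
  refine ⟨x, y, ?_⟩
  suffices z = 0 by simpa [this] using hxyz
  have h₁ : (0 : ℝ) < A₁ := Nat.cast_pos.mpr h.pos₁
  have h₂ : (0 : ℝ) < A₂ := Nat.cast_pos.mpr h.pos₂
  have htr : Algebra.trace ℤ (𝓞 K) (γ * α) = A₁ * A₂ * z := by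
    have : (3 : ℤ) * (γ * α) = (z * (A₁ * A₂) : ℤ) + x * α + (y * A₂ : ℤ) * β := by
      push_cast
      linear_combination α * hxyz + (z : 𝓞 K) * h.mul_eq + (y : 𝓞 K) * h.mul_self_left
    have := congrArg (Algebra.trace ℤ (𝓞 K)) this
    rw [h.trace_add_mul_add_mul, ← zsmul_eq_mul, map_zsmul, smul_eq_mul] at this
    linarith
  have hsum : (A₁ * A₂ * z : ℂ) = ∑ σ : K →ₐ[ℚ] ℂ, σ (γ : K) * σ (α : K) := by
    have h1 := trace_eq_sum_embeddings (K := ℚ) (L := K) ℂ (x := ((γ * α : 𝓞 K) : K))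
    rw [← Algebra.coe_trace_int, htr] at h1
    simpa using h1
  have hB0 : 0 ≤ B := by
    obtain ⟨w⟩ := (inferInstance : Nonempty (InfinitePlace K))
    exact (apply_nonneg w _).trans (hB w)
  set r : ℝ := ((A₁ : ℝ) * A₂ ^ 2) ^ ((1 : ℝ) / 3) with hr
  have hr3 : r ^ 3 = A₁ * A₂ ^ 2 := by
    rw [hr, ← Real.rpow_mul_natCast (by positivity)]; norm_num
  have hα (σ : K →ₐ[ℚ] ℂ) : ‖σ (α : K)‖ = r := by
    have h1 : σ (α : K) ^ 3 = A₁ * A₂ ^ 2 := by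
      have : ((α ^ 3 : 𝓞 K) : K) = ((A₁ * A₂ ^ 2 : 𝓞 K) : K) := by rw [h.cube_left]
      have := congrArg σ this
      simpa using this
    have h2 : ‖σ (α : K)‖ ^ 3 = r ^ 3 := by
      rw [← norm_pow, h1, hr3]; simp
    exact (pow_left_inj₀ (norm_nonneg _) (by positivity) three_ne_zero).mp h2
  have hle : (A₁ * A₂ : ℝ) * |(z : ℝ)| ≤ 3 * (B * r) := by
    calc (A₁ * A₂ : ℝ) * |(z : ℝ)| = ‖(A₁ * A₂ * z : ℂ)‖ := by simp
      _ ≤ ∑ σ : K →ₐ[ℚ] ℂ, ‖σ (γ : K) * σ (α : K)‖ := by rw [hsum]; exact norm_sum_le _ _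
      _ ≤ ∑ σ : K →ₐ[ℚ] ℂ, B * r := by
        refine Finset.sum_le_sum fun σ _ ↦ ?_
        rw [norm_mul, hα]
        gcongr
        have := hB (InfinitePlace.mk σ.toRingHom)
        rwa [InfinitePlace.apply] at this
      _ = _ := by
        rw [Finset.sum_const, Finset.card_univ, AlgHom.card, h.finrank_eq]; simp
  by_contra hz
  have hz1 : (1 : ℝ) ≤ |(z : ℝ)| := by exact_mod_cast Int.one_le_abs hz
  have h3 : (A₁ * A₂ : ℝ) ≤ 3 * (B * r) := by
    refine le_trans ?_ hle
    exact le_mul_of_one_le_right (by positivity) hz1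
  have h4 : (A₁ * A₂ : ℝ) ^ 3 ≤ (27 * B ^ 3) * (A₁ * A₂ ^ 2) := by
    calc _ ≤ (3 * (B * r)) ^ 3 := by gcongr
      _ = _ := by rw [← hr3]; ring
  have h5 : (27 * B ^ 3) * (A₁ * A₂ ^ 2) < (A₁ ^ 2 * A₂) * (A₁ * A₂ ^ 2 : ℝ) := by gcongr
  nlinarith

/-- A prime `p ≡ 2 mod 3` prime to `A₁ * A₂` splits as `P * Q` with `P` of degree one and `Q` of
degree two. -/
theorem exists_ideals_of_prime (h : IsPureCubicPair A₁ A₂ α β)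
    {p : ℕ} (hp : p.Prime) (hp3 : p % 3 = 2)
    (hpA : ¬ p ∣ A₁ * A₂) : ∃ P Q : Ideal (𝓞 K), P * Q = Ideal.span {(p : 𝓞 K)} ∧
      IsCoprime P Q ∧ P ≠ ⊤ ∧
      ∀ x y : ℤ, (x + y * α : 𝓞 K) ∈ Q → (p : ℤ) ∣ x ∧ (p : ℤ) ∣ y := by
  have hpF : Fact p.Prime := ⟨hp⟩
  have hpZ : Prime (p : ℤ) := Nat.prime_iff_prime_int.mp hp
  have hp3' : ¬ (p : ℤ) ∣ 3 := by
    intro h3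
    have : p ∣ 3 := by exact_mod_cast h3
    rcases (Nat.dvd_prime Nat.prime_three).mp this with rfl | rfl
    · exact hp.one_lt.ne rfl
    · omega
  have hpT : ¬ (p : ℤ) ∣ A₁ * A₂ := by exact_mod_cast hpA
  obtain ⟨b, hb⟩ : ∃ b : ℤ, (p : ℤ) ∣ A₁ * A₂ ^ 2 - b ^ 3 := by
    obtain ⟨m, rfl⟩ : ∃ m, p = 3 * m + 2 := ⟨p / 3, by omega⟩
    refine ⟨(A₁ * A₂ ^ 2) ^ (2 * m + 1), ?_⟩
    rw [← ZMod.intCast_zmod_eq_zero_iff_dvd]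
    push_cast
    rw [sub_eq_zero, ← pow_mul]
    have h1 := ZMod.pow_card ((A₁ * A₂ ^ 2 : ZMod (3 * m + 2)))
    have h2 : (2 * m + 1) * 3 = (3 * m + 2) + (3 * m + 1) := by ring
    rw [h2, pow_add, h1, ← pow_succ', h1]
  have hpb : ¬ (p : ℤ) ∣ b := by
    intro hdvd
    have h1 : (p : ℤ) ∣ A₁ * A₂ ^ 2 := by
      rw [← sub_add_cancel ((A₁ * A₂ ^ 2 : ℤ)) (b ^ 3)]
      exact dvd_add hb (dvd_pow hdvd three_ne_zero)
    refine hpT ?_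
    rcases hpZ.dvd_or_dvd h1 with h1 | h1
    · exact dvd_mul_of_dvd_left h1 _
    · exact dvd_mul_of_dvd_right (hpZ.dvd_of_dvd_pow h1) _
  have hp3b : ¬ (p : ℤ) ∣ 3 * b := fun h1 ↦ (hpZ.dvd_or_dvd h1).elim hp3' hpb
  have hp3b2 : ¬ (p : ℤ) ∣ 3 * b ^ 2 := fun h1 ↦
    (hpZ.dvd_or_dvd h1).elim hp3' fun h2 ↦ hpb (hpZ.dvd_of_dvd_pow h2)
  let P : Ideal (𝓞 K) := Ideal.span {(p : 𝓞 K), α - b}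
  let Q : Ideal (𝓞 K) := Ideal.span {(p : 𝓞 K), α ^ 2 + b * α + b ^ 2}
  have hpP : (p : 𝓞 K) ∈ P := Ideal.subset_span (by simp)
  have hαP : α - b ∈ P := Ideal.subset_span (by simp)
  have hpQ : (p : 𝓞 K) ∈ Q := Ideal.subset_span (by simp)
  have hαQ : α ^ 2 + b * α + b ^ 2 ∈ Q := Ideal.subset_span (by simp)
  have hcop : P ⊔ Q = ⊤ := by
    obtain ⟨u, v, huv⟩ := (Int.isCoprime_iff_gcd_eq_one.mpr
      (Int.isCoprime_iff_gcd_eq_one.mp ((hpZ.coprime_iff_not_dvd).mpr hp3b2)))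
    rw [Ideal.eq_top_iff_one]
    have h1 : (1 : 𝓞 K) = (u * p + -(v * (α + 2 * b)) * (α - b)) +
        v * (α ^ 2 + b * α + b ^ 2) := by
      have : (u * p + v * (3 * b ^ 2) : 𝓞 K) = 1 := by exact_mod_cast huv
      linear_combination -this
    rw [h1]
    exact Ideal.add_mem _ (Ideal.mem_sup_left (Ideal.add_mem _ (P.mul_mem_left _ hpP)
      (P.mul_mem_left _ hαP))) (Ideal.mem_sup_right (Q.mul_mem_left _ hαQ))
  have hPQ : P * Q = Ideal.span {(p : 𝓞 K)} := by
    refine le_antisymm ?_ ?_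
    · obtain ⟨c, hc⟩ := hb
      rw [Ideal.span_mul_span', Ideal.span_le]
      rintro _ ⟨x, hx, y, hy, rfl⟩
      simp only [Set.mem_insert_iff, Set.mem_singleton_iff] at hx hy
      rw [SetLike.mem_coe, Ideal.mem_span_singleton]
      rcases hx with rfl | rfl
      · exact dvd_mul_right _ _
      · rcases hy with rfl | rfl
        · exact dvd_mul_left _ _
        · have hc' : (A₁ * A₂ ^ 2 - b ^ 3 : 𝓞 K) = p * c := by exact_mod_cast hc
          exact ⟨c, by linear_combination h.cube_left + hc'⟩
    · rw [Ideal.mul_eq_inf_of_coprime hcop, Ideal.span_singleton_le_iff_mem]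
      exact ⟨hpP, hpQ⟩
  refine ⟨P, Q, hPQ, Ideal.isCoprime_iff_sup_eq.mpr hcop, fun htop ↦ ?_, fun x y hxy ↦ ?_⟩
  · rw [htop, Ideal.top_mul] at hPQ
    rw [hPQ] at hαQ
    refine hp3b2 ?_
    have h1 := dvd_trace_of_mem_span hαQ
    have h2 : α ^ 2 + b * α + b ^ 2 = ((b ^ 2 : ℤ) : 𝓞 K) + b * α + (A₂ : ℤ) * β := by
      push_cast; linear_combination h.mul_self_left
    rwa [h2, h.trace_add_mul_add_mul] at h1
  · have hmem : (x + y * α) * (α - b) ∈ Ideal.span {(p : 𝓞 K)} := by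
      rw [← hPQ, mul_comm P]
      exact Ideal.mul_mem_mul hxy hαP
    have hcomb : (x + y * α) * (α - b) =
        ((-(b * x) : ℤ) : 𝓞 K) + (x - b * y : ℤ) * α + (y * A₂ : ℤ) * β := by
      push_cast; linear_combination (y : 𝓞 K) * h.mul_self_left
    have hx : (p : ℤ) ∣ x := by
      have h1 := dvd_trace_of_mem_span hmem
      rw [hcomb, h.trace_add_mul_add_mul, show 3 * -(b * x) = -(3 * b * x) by ring, dvd_neg] at h1
      exact (hpZ.dvd_or_dvd h1).resolve_left hp3b
    refine ⟨hx, ?_⟩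
    have h1 := dvd_trace_of_mem_span (Ideal.mul_mem_right β _ hmem)
    have hcomb' : (x + y * α) * (α - b) * β = (((x - b * y) * (A₁ * A₂) : ℤ) : 𝓞 K) +
        (y * A₂ * A₁ : ℤ) * α + (-(b * x) : ℤ) * β := by
      rw [hcomb]; push_cast
      linear_combination ((x : 𝓞 K) - b * y) * h.mul_eq + ((y : 𝓞 K) * A₂) * h.mul_self_right
    rw [hcomb', h.trace_add_mul_add_mul] at h1
    have h2 : (p : ℤ) ∣ 3 * b * (A₁ * A₂ * y) := by
      have h3 : 3 * b * (A₁ * A₂ * y) =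
          x * (3 * (A₁ * A₂)) - 3 * ((x - b * y) * (A₁ * A₂)) := by ring
      rw [h3]
      exact dvd_sub (dvd_mul_of_dvd_left hx _) h1
    exact (hpZ.dvd_or_dvd ((hpZ.dvd_or_dvd h2).resolve_left hp3b)).resolve_left hpT

theorem not_forall_le_of_span_eq (h : IsPureCubicPair A₁ A₂ α β)
    {ℓ p q : ℕ} (hℓ : 0 < ℓ) (hp : p.Prime) (hq : q.Prime)
    (hpq : p ≠ q) (hq3 : q ≠ 3) {X : ℝ} (hqX : (q : ℝ) ≤ X)
    (hX : 27 * (2 * X ^ ℓ) ^ 3 < (A₁ : ℝ) ^ 2 * A₂) {P P' Q' : Ideal (𝓞 K)}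
    (hP : (p : 𝓞 K) ∈ P) (hPQ : P' * Q' = Ideal.span {(q : 𝓞 K)})
    (hcop : IsCoprime P' Q') (hP' : P' ≠ ⊤)
    (hQ' : ∀ x y : ℤ, (x + y * α : 𝓞 K) ∈ Q' → (q : ℤ) ∣ x ∧ (q : ℤ) ∣ y)
    {A : Ideal (𝓞 K)} (hA : A ≠ ⊥) {δ δ' : 𝓞 K} (hδ : Ideal.span {δ} = (A * P) ^ ℓ)
    (hδ' : Ideal.span {δ'} = (A * P') ^ ℓ) : ¬ ∀ w : InfinitePlace K, w (δ : K) ≤ 2 * w (δ' : K) := by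
  intro hw
  have hq0 : (q : 𝓞 K) ≠ 0 := by exact_mod_cast hq.ne_zero
  have hP'0 : P' ≠ ⊥ := by
    rintro rfl
    rw [Ideal.bot_mul, eq_comm, Ideal.span_singleton_eq_bot] at hPQ
    exact hq0 hPQ
  have hδ'0 : δ' ≠ 0 := by
    rintro rfl
    rw [Ideal.span_singleton_eq_bot.mpr rfl, eq_comm] at hδ'
    exact mul_ne_zero hA hP'0 (pow_eq_zero_iff hℓ.ne' |>.mp hδ')
  have hmul : Ideal.span {δ * (q : 𝓞 K) ^ ℓ} = Ideal.span {δ'} * (P ^ ℓ * Q' ^ ℓ) := by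
    rw [← Ideal.span_singleton_mul_span_singleton, ← Ideal.span_singleton_pow, ← hPQ, hδ, hδ',
      mul_pow, mul_pow, mul_pow]
    ring
  obtain ⟨γ, hγ⟩ : δ' ∣ δ * (q : 𝓞 K) ^ ℓ := by
    rw [← Ideal.mem_span_singleton, ← Ideal.span_singleton_le_iff_mem, hmul]
    exact Ideal.mul_le_left
  have hγspan : Ideal.span {γ} = P ^ ℓ * Q' ^ ℓ := by
    rw [hγ, ← Ideal.span_singleton_mul_span_singleton] at hmul
    refine mul_left_cancel₀ ?_ hmul
    rwa [Ne, Ideal.zero_eq_bot, Ideal.span_singleton_eq_bot]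
  have hγw (w : InfinitePlace K) : w (γ : K) ≤ 2 * X ^ ℓ := by
    have hw' : 0 < w (δ' : K) := w.pos_iff.mpr (by exact_mod_cast hδ'0)
    have h1 : w (δ : K) * (q : ℝ) ^ ℓ = w (δ' : K) * w (γ : K) := by
      have := congrArg (fun x : 𝓞 K ↦ w (x : K)) hγ
      simpa [map_mul, map_pow] using this
    have h2 : w (δ' : K) * w (γ : K) ≤ w (δ' : K) * (2 * X ^ ℓ) := by
      rw [← h1]
      calc _ ≤ (2 * w (δ' : K)) * X ^ ℓ := by gcongr; exact hw w
        _ = _ := by ring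
    exact le_of_mul_le_mul_left h2 hw'
  obtain ⟨x, y, hxy⟩ := h.exists_three_mul_eq_of_lt hγw hX
  have hγQ : γ ∈ Q' := by
    rw [← Ideal.span_singleton_le_iff_mem, hγspan]
    exact Ideal.mul_le_right.trans (Ideal.pow_le_self hℓ.ne')
  obtain ⟨⟨x', rfl⟩, y', rfl⟩ := hQ' x y (hxy ▸ Q'.mul_mem_left _ hγQ)
  have hγP' : γ ∈ P' := by
    have h3 : IsCoprime (3 : ℤ) q := by
      rw [Int.isCoprime_iff_gcd_eq_one]
      exact_mod_cast (Nat.coprime_primes Nat.prime_three hq).mpr hq3.symm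
    obtain ⟨u, v, huv⟩ := h3
    have huv' : (u * 3 + v * q : 𝓞 K) = 1 := by exact_mod_cast huv
    have h4 : γ = (u * (x' + y' * α) + v * γ) * q := by
      push_cast at hxy
      linear_combination (-γ) * huv' + u * hxy
    rw [h4]
    refine P'.mul_mem_left _ ?_
    rw [← Ideal.span_singleton_le_iff_mem, ← hPQ]
    exact Ideal.mul_le_left
  have hcopP : IsCoprime P P' := by
    obtain ⟨u, v, huv⟩ := Nat.isCoprime_iff_coprime.mpr ((Nat.coprime_primes hp hq).mpr hpq)
    have huv' : (u * p + v * q : 𝓞 K) = 1 := by exact_mod_cast huv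
    rw [Ideal.isCoprime_iff_sup_eq, Ideal.eq_top_iff_one, ← huv']
    refine Ideal.add_mem _ (Ideal.mem_sup_left (P.mul_mem_left _ hP))
      (Ideal.mem_sup_right (P'.mul_mem_left _ ?_))
    rw [← Ideal.span_singleton_le_iff_mem, ← hPQ]
    exact Ideal.mul_le_left
  have htop : IsCoprime (P ^ ℓ * Q' ^ ℓ) P' := (hcopP.pow_left).mul_left (hcop.symm.pow_left)
  rw [← hγspan, Ideal.isCoprime_iff_sup_eq, sup_eq_right.mpr
    ((Ideal.span_singleton_le_iff_mem _).mpr hγP')] at htop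
  exact hP' htop

theorem absNorm_le_pow_three (h : IsPureCubicPair A₁ A₂ α β)
    {p : ℕ} (hp : 0 < p) {P Q : Ideal (𝓞 K)}
    (hPQ : P * Q = Ideal.span {(p : 𝓞 K)}) : P ≠ ⊥ ∧ Ideal.absNorm P ≤ p ^ 3 := by
  have hnorm : Ideal.absNorm (P * Q) = p ^ 3 := by
    rw [hPQ, Ideal.absNorm_span_singleton, ← Int.cast_natCast, ← eq_intCast (algebraMap ℤ (𝓞 K)),
      Algebra.norm_algebraMap, Int.natAbs_pow, Int.natAbs_natCast, RingOfIntegers.rank,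
      h.finrank_eq]
  refine ⟨?_, Nat.le_of_dvd (pow_pos hp 3) (hnorm ▸ map_mul Ideal.absNorm P Q ▸ dvd_mul_right _ _)⟩
  rintro rfl
  rw [Ideal.bot_mul, Ideal.absNorm_bot] at hnorm
  exact (pow_pos hp 3).ne hnorm

end IsPureCubicPair

end PureCubic

section PureCubicPair

open Module

variable {K : Type*} [Field K] [NumberField K]

theorem trace_eq_zero_of_pow_three_eq (hK : finrank ℚ K = 3) {x : K} {c : ℚ}
    (hx : IntermediateField.adjoin ℚ {x} = ⊤) (hc : x ^ 3 = algebraMap ℚ K c) :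
    Algebra.trace ℚ K x = 0 := by
  have hint : IsIntegral ℚ x := Algebra.IsIntegral.isIntegral x
  have hdeg : (minpoly ℚ x).natDegree = 3 := by
    rw [← IntermediateField.adjoin.finrank hint, hx, IntermediateField.finrank_top', hK]
  have hmin : minpoly ℚ x = X ^ 3 - C c := by
    have hm : (X ^ 3 - C c : ℚ[X]).Monic := monic_X_pow_sub_C c three_ne_zero
    refine (eq_of_monic_of_dvd_of_natDegree_le (minpoly.monic hint) hm
      (minpoly.dvd ℚ x (by simp [hc])) ?_).symm
    rw [hdeg, natDegree_X_pow_sub_C]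
  rw [trace_eq_finrank_mul_minpoly_nextCoeff, hmin,
    nextCoeff_of_natDegree_pos (by simp), natDegree_X_pow_sub_C]
  simp [coeff_X_pow]

theorem exists_isPureCubicPair {A₁ A₂ a : ℕ} {θ : K} (hA₁ : Squarefree A₁) (hA₂ : Squarefree A₂)
    (hcop : Nat.Coprime A₁ A₂) (ha : a = A₁ * A₂ ^ 2) (hθ : θ ^ 3 = a)
    (htop : IntermediateField.adjoin ℚ {θ} = ⊤) (hK : finrank ℚ K = 3) :
    ∃ α β : 𝓞 K, IsPureCubicPair A₁ A₂ α β := by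
  have h₁ : (A₁ : K) ≠ 0 := by exact_mod_cast hA₁.ne_zero
  have h₂ : (A₂ : K) ≠ 0 := by exact_mod_cast hA₂.ne_zero
  have hθ' : θ ^ 3 = A₁ * A₂ ^ 2 := by rw [hθ, ha]; push_cast; rfl
  have hθ0 : θ ≠ 0 := by
    rintro rfl
    rw [zero_pow three_ne_zero] at hθ'
    exact mul_ne_zero h₁ (pow_ne_zero 2 h₂) hθ'.symm
  set φ : K := θ ^ 2 / A₂ with hφ
  have hφ3 : φ ^ 3 = A₁ ^ 2 * A₂ := by
    rw [hφ]; field_simp; linear_combination (θ ^ 3 + A₁ * A₂ ^ 2) * hθ'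
  have hφθ : θ = φ ^ 2 / A₁ := by
    rw [hφ]; field_simp; linear_combination -hθ'
  have htop' : IntermediateField.adjoin ℚ {φ} = ⊤ := by
    rw [eq_top_iff, ← htop, IntermediateField.adjoin_simple_le_iff, hφθ]
    exact div_mem (pow_mem (IntermediateField.mem_adjoin_simple_self ℚ φ) 2) (natCast_mem _ _)
  have hθint : IsIntegral ℤ θ := by
    refine IsIntegral.of_pow three_pos ?_
    rw [hθ]; exact isIntegral_natCast a
  have hφint : IsIntegral ℤ φ := by
    refine IsIntegral.of_pow three_pos ?_
    rw [hφ3]; exact ((isIntegral_natCast A₁).pow 2).mul (isIntegral_natCast A₂)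
  obtain ⟨α, hα⟩ : ∃ α : 𝓞 K, algebraMap (𝓞 K) K α = θ := ⟨⟨θ, hθint⟩, rfl⟩
  obtain ⟨β, hβ⟩ : ∃ β : 𝓞 K, algebraMap (𝓞 K) K β = φ := ⟨⟨φ, hφint⟩, rfl⟩
  refine ⟨α, β, Nat.pos_of_ne_zero hA₁.ne_zero, Nat.pos_of_ne_zero hA₂.ne_zero,
    (Nat.squarefree_mul hcop).mpr ⟨hA₁, hA₂⟩, ?_, ?_, ?_, ?_, ?_, hK⟩
  · apply RingOfIntegers.coe_injective
    simp only [map_mul, map_natCast]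
    rw [hα, hβ, hφ]; field_simp
  · apply RingOfIntegers.coe_injective
    simp only [map_mul, map_natCast]
    rw [hα, hβ, hφθ]; field_simp
  · apply RingOfIntegers.coe_injective
    simp only [map_mul, map_natCast]
    rw [hα, hβ, hφ]; field_simp; linear_combination hθ'
  · rw [← Int.cast_inj (α := ℚ), Algebra.coe_trace_int, Int.cast_zero]
    change Algebra.trace ℚ K (algebraMap (𝓞 K) K α) = 0
    rw [hα]
    exact trace_eq_zero_of_pow_three_eq hK htop (c := a) (by simp [hθ])
  · rw [← Int.cast_inj (α := ℚ), Algebra.coe_trace_int, Int.cast_zero]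
    change Algebra.trace ℚ K (algebraMap (𝓞 K) K β) = 0
    rw [hβ]
    exact trace_eq_zero_of_pow_three_eq hK htop' (c := A₁ ^ 2 * A₂) (by simp [hφ3])

end PureCubicPair

section Torsion

open Module

theorem Nat.card_primeFactors_le_log {n : ℕ} (hn : n ≠ 0) : n.primeFactors.card ≤ Nat.log 2 n := by
  refine Nat.le_log_of_pow_le one_lt_two ?_
  calc 2 ^ n.primeFactors.card ≤ ∏ p ∈ n.primeFactors, p :=
        Finset.pow_card_le_prod _ _ _ fun p hp ↦ (Nat.prime_of_mem_primeFactors hp).two_le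
    _ ≤ n := Nat.le_of_dvd (Nat.pos_of_ne_zero hn) (Nat.prod_primeFactors_dvd n)

theorem exists_log_add_one_pow_le_rpow {η : ℝ} (hη : 0 < η) (k : ℕ) :
    ∃ C : ℝ, 0 < C ∧ ∀ n : ℕ, n ≠ 0 → ((Nat.log 2 n : ℝ) + 1) ^ k ≤ C * (n : ℝ) ^ η := by
  have hk : (0 : ℝ) < k + 1 := by positivity
  set κ : ℝ := η / (k + 1) with hκ
  have hκ0 : 0 < κ := div_pos hη hk
  refine ⟨(2 / κ + 1) ^ k, by positivity, fun n hn ↦ ?_⟩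
  have hn1 : (1 : ℝ) ≤ n := by exact_mod_cast Nat.one_le_iff_ne_zero.mpr hn
  have hlog : (Nat.log 2 n : ℝ) ≤ 2 * Real.log n := by
    have h1 : (Nat.log 2 n : ℝ) * Real.log 2 ≤ Real.log n := by
      rw [← Real.log_pow]
      refine Real.log_le_log (by positivity) ?_
      exact_mod_cast Nat.pow_log_le_self 2 hn
    nlinarith [Real.log_two_gt_d9, (Nat.cast_nonneg (Nat.log 2 n) : (0 : ℝ) ≤ _)]
  have h2 : (Nat.log 2 n : ℝ) + 1 ≤ (2 / κ + 1) * (n : ℝ) ^ κ := by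
    have h3 := Real.log_le_rpow_div (x := n) (by positivity) hκ0
    have h4 : 1 ≤ (n : ℝ) ^ κ := Real.one_le_rpow hn1 hκ0.le
    have h5 : (2 / κ + 1) * (n : ℝ) ^ κ = 2 * ((n : ℝ) ^ κ / κ) + (n : ℝ) ^ κ := by ring
    linarith
  calc ((Nat.log 2 n : ℝ) + 1) ^ k ≤ ((2 / κ + 1) * (n : ℝ) ^ κ) ^ k := by gcongr
    _ = (2 / κ + 1) ^ k * (n : ℝ) ^ (κ * k) := by
      rw [mul_pow, ← Real.rpow_mul_natCast (by positivity)]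
    _ ≤ _ := by
      gcongr
      rw [hκ, div_mul_eq_mul_div, div_le_iff₀ hk]
      nlinarith

namespace IsPureCubicPair

variable {K : Type*} [Field K] [NumberField K] {A₁ A₂ : ℕ} {α β : 𝓞 K}

theorem card_torsion_mul_card_le_of_absNorm_le (h : IsPureCubicPair A₁ A₂ α β) {ℓ : ℕ}
    (hℓ : 0 < ℓ) {s : ℝ} (hs : 1 < s) {ι : Type*} (S : Finset ι) (P : ι → Ideal (𝓞 K))
    (hP : ∀ i ∈ S, P i ≠ ⊥) (hR : ∀ i ∈ S, Ideal.absNorm (P i) ≤ (A₁ * A₂) ^ 3)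
    (hsep : ∀ i ∈ S, ∀ j ∈ S, i ≠ j → ∀ A : Ideal (𝓞 K), A ≠ ⊥ → ∀ δ δ' : 𝓞 K,
      Ideal.span {δ} = (A * P i) ^ ℓ → Ideal.span {δ'} = (A * P j) ^ ℓ →
      ¬ ∀ w : InfinitePlace K, w (δ : K) ≤ 2 * w (δ' : K)) :
    (Nat.card {c : ClassGroup (𝓞 K) // c ^ ℓ = 1} : ℝ) * S.card ≤
      (∑' k : ℕ, 1 / (k : ℝ) ^ s) ^ 3 * (47 * (A₁ * A₂ : ℕ) : ℝ) ^ s *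
        (41 * ℓ * ((Nat.log 2 (A₁ * A₂) : ℝ) + 1)) ^ 3 := by
  classical
  have hT0 : A₁ * A₂ ≠ 0 := (Nat.mul_pos h.pos₁ h.pos₂).ne'
  have hD := h.natAbs_discr_bounds.2
  generalize A₁ * A₂ = T at *
  set m := Nat.log 2 T with hm
  have hT1 : (1 : ℝ) ≤ T := by exact_mod_cast Nat.one_le_iff_ne_zero.mpr hT0
  let F : Finset (Ideal (𝓞 K)) :=
    ((Ideal.finite_setOfPred_absNorm_le (S := 𝓞 K) (47 * T)).toFinset).filter (· ≠ ⊥)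
  have hM : 2 ^ finrank ℚ K * √|(discr K : ℝ)| < ((47 * T : ℕ) : ℝ) := by
    have h1 : |(discr K : ℝ)| ≤ 27 * (T : ℝ) ^ 2 := by
      rw [← Int.cast_abs, Int.abs_eq_natAbs]
      exact_mod_cast hD
    have h2 : √|(discr K : ℝ)| < 47 / 8 * T := by
      rw [Real.sqrt_lt' (by positivity)]
      nlinarith
    rw [h.finrank_eq]
    push_cast
    linarith
  have hL : (((47 * T : ℕ) : ℝ) * (T : ℝ) ^ 3) ^ ((ℓ : ℝ) / finrank ℚ K) ≤
      2 ^ ((10 + 4 * m) * ℓ) := by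
    have hTm : (T : ℝ) ≤ 2 ^ (m + 1) := by
      exact_mod_cast (Nat.lt_pow_succ_log_self one_lt_two T).le
    have h1 : (1 : ℝ) ≤ ((47 * T : ℕ) : ℝ) * (T : ℝ) ^ 3 := by
      push_cast
      nlinarith [one_le_pow₀ hT1 (n := 3)]
    have h2 : ((47 * T : ℕ) : ℝ) * (T : ℝ) ^ 3 ≤ 2 ^ (10 + 4 * m) := by
      calc ((47 * T : ℕ) : ℝ) * (T : ℝ) ^ 3 = 47 * (T : ℝ) ^ 4 := by push_cast; ring
        _ ≤ 64 * (2 ^ (m + 1)) ^ 4 := by gcongr; norm_num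
        _ = _ := by rw [← pow_mul]; ring
    calc _ ≤ (((47 * T : ℕ) : ℝ) * (T : ℝ) ^ 3) ^ (ℓ : ℝ) := by
          refine Real.rpow_le_rpow_of_exponent_le h1 ?_
          rw [h.finrank_eq]
          exact div_le_self (by positivity) (by norm_num)
      _ ≤ (2 ^ (10 + 4 * m)) ^ ℓ := by rw [Real.rpow_natCast]; gcongr
      _ = _ := (pow_mul _ _ _).symm
  have key := card_torsion_mul_card_le K hℓ S P hP hM (R := (T : ℝ) ^ 3)
    (fun i hi ↦ by exact_mod_cast hR i hi) hL hsep F fun A hA hAM ↦ by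
      simp only [F, Finset.mem_filter, Set.Finite.mem_toFinset]
      exact ⟨by exact_mod_cast hAM, hA⟩
  have hF := card_ideal_absNorm_le K hs (47 * T) F fun I hI ↦ by
    simp only [F, Finset.mem_filter, Set.Finite.mem_toFinset] at hI
    exact ⟨hI.2, hI.1⟩
  rw [h.finrank_eq] at key hF
  have hℓ1 : (1 : ℝ) ≤ ℓ := by exact_mod_cast hℓ
  calc _ ≤ (F.card : ℝ) * ((3 + 1) * ((10 + 4 * m) * ℓ) + 1) ^ 3 := by exact_mod_cast key
    _ ≤ _ := by
      gcongr
      · exact_mod_cast hF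
      · nlinarith [(Nat.cast_nonneg m : (0 : ℝ) ≤ m)]

theorem card_torsion_mul_card_primes_le (h : IsPureCubicPair A₁ A₂ α β) {ℓ : ℕ}
    (hℓ : 0 < ℓ) {s : ℝ} (hs : 1 < s) {X : ℝ} (hX0 : 0 ≤ X) (hXT : X ≤ (A₁ * A₂ : ℕ))
    (hX : 27 * (2 * X ^ ℓ) ^ 3 < (A₁ : ℝ) ^ 2 * A₂) :
    (Nat.card {c : ClassGroup (𝓞 K) // c ^ ℓ = 1} : ℝ) *
      (((Finset.range (⌊X⌋₊ + 1)).filter fun p ↦ p.Prime ∧ p % 3 = 2).card + 1) ≤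
      2 * ((∑' k : ℕ, 1 / (k : ℝ) ^ s) ^ 3 * 47 ^ s * (41 * ℓ) ^ 3) *
        ((Nat.log 2 (A₁ * A₂) : ℝ) + 1) ^ 4 * ((A₁ * A₂ : ℕ) : ℝ) ^ s := by
  classical
  have hT0 : A₁ * A₂ ≠ 0 := (Nat.mul_pos h.pos₁ h.pos₂).ne'
  set B : ℝ := (∑' k : ℕ, 1 / (k : ℝ) ^ s) ^ 3 * (47 * (A₁ * A₂ : ℕ) : ℝ) ^ s *
    (41 * ℓ * ((Nat.log 2 (A₁ * A₂) : ℝ) + 1)) ^ 3 with hB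
  set S₀ := (Finset.range (⌊X⌋₊ + 1)).filter fun p ↦ p.Prime ∧ p % 3 = 2 with hS₀
  set S := S₀.filter fun p ↦ ¬ p ∣ A₁ * A₂ with hS
  have hmem {p : ℕ} (hp : p ∈ S) : p.Prime ∧ p % 3 = 2 ∧ ¬ p ∣ A₁ * A₂ ∧ (p : ℝ) ≤ X := by
    simp only [hS, hS₀, Finset.mem_filter, Finset.mem_range, Nat.lt_succ_iff] at hp
    exact ⟨hp.1.2.1, hp.1.2.2, hp.2, (Nat.le_floor_iff hX0).mp hp.1.1⟩
  have hex (p : ℕ) : ∃ P Q : Ideal (𝓞 K), p ∈ S → P * Q = Ideal.span {(p : 𝓞 K)} ∧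
      IsCoprime P Q ∧ P ≠ ⊤ ∧
      ∀ x y : ℤ, (x + y * α : 𝓞 K) ∈ Q → (p : ℤ) ∣ x ∧ (p : ℤ) ∣ y := by
    by_cases hp : p ∈ S
    · obtain ⟨h1, h2, h3, -⟩ := hmem hp
      obtain ⟨P, Q, hPQ⟩ := h.exists_ideals_of_prime h1 h2 h3
      exact ⟨P, Q, fun _ ↦ hPQ⟩
    · exact ⟨⊤, ⊤, fun h ↦ absurd h hp⟩
  choose P Q hPQ using hex
  have h1 : (Nat.card {c : ClassGroup (𝓞 K) // c ^ ℓ = 1} : ℝ) * S.card ≤ B := by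
    refine h.card_torsion_mul_card_le_of_absNorm_le hℓ hs S P
      (fun p hp ↦ (h.absNorm_le_pow_three (hmem hp).1.pos (hPQ p hp).1).1) (fun p hp ↦ ?_)
      fun p hp q hq hpq A hA δ δ' hδ hδ' ↦ ?_
    · refine (h.absNorm_le_pow_three (hmem hp).1.pos (hPQ p hp).1).2.trans ?_
      have : p ≤ A₁ * A₂ := by exact_mod_cast (hmem hp).2.2.2.trans hXT
      gcongr
    · obtain ⟨e1, e2, e3, e4⟩ := hPQ q hq
      obtain ⟨q1, q2, -, q3⟩ := hmem hq
      refine h.not_forall_le_of_span_eq hℓ (hmem hp).1 q1 hpq (by omega) q3 hX ?_ e1 e2 e3 e4 hA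
        hδ hδ'
      rw [← Ideal.span_singleton_le_iff_mem, ← (hPQ p hp).1]
      exact Ideal.mul_le_left
  have h2 : (Nat.card {c : ClassGroup (𝓞 K) // c ^ ℓ = 1} : ℝ) ≤ B := by
    have := h.card_torsion_mul_card_le_of_absNorm_le hℓ hs {()} (fun _ ↦ ⊤)
      (fun _ _ ↦ top_ne_bot) (fun _ _ ↦ by
        rw [Ideal.absNorm_top]; exact Nat.one_le_pow _ _ (Nat.pos_of_ne_zero hT0))
      (fun i _ j _ hij ↦ absurd rfl hij)
    rwa [Finset.card_singleton, Nat.cast_one, mul_one] at this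
  have hcard : S₀.card ≤ S.card + Nat.log 2 (A₁ * A₂) := by
    rw [← Finset.card_filter_add_card_filter_not (s := S₀) (fun p ↦ ¬ p ∣ A₁ * A₂)]
    gcongr
    refine le_trans (Finset.card_le_card fun p hp ↦ ?_) (Nat.card_primeFactors_le_log hT0)
    simp only [hS₀, Finset.mem_filter, not_not] at hp
    exact Nat.mem_primeFactors.mpr ⟨hp.1.2.1, hp.2, hT0⟩
  have hcard' : (S₀.card : ℝ) ≤ S.card + Nat.log 2 (A₁ * A₂) := by exact_mod_cast hcard
  have hB' : 2 * ((∑' k : ℕ, 1 / (k : ℝ) ^ s) ^ 3 * 47 ^ s * (41 * ℓ) ^ 3) *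
        ((Nat.log 2 (A₁ * A₂) : ℝ) + 1) ^ 4 * ((A₁ * A₂ : ℕ) : ℝ) ^ s =
      2 * ((Nat.log 2 (A₁ * A₂) : ℝ) + 1) * B := by
    rw [hB, Real.mul_rpow (by norm_num) (by positivity)]
    ring
  rw [hB']
  have hN : (0 : ℝ) ≤ Nat.card {c : ClassGroup (𝓞 K) // c ^ ℓ = 1} := Nat.cast_nonneg _
  generalize (Nat.card {c : ClassGroup (𝓞 K) // c ^ ℓ = 1} : ℝ) = N at *
  have hm : (0 : ℝ) ≤ Nat.log 2 (A₁ * A₂) := Nat.cast_nonneg _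
  nlinarith [mul_le_mul_of_nonneg_left hcard' hN, mul_le_mul_of_nonneg_left h2 hm]

end IsPureCubicPair

theorem card_torsion_le_of_isPureCubicPair (ℓ : ℕ) (hℓ : 0 < ℓ) (ε : ℝ) (hε : 0 < ε) :
    ∃ C : ℝ, 0 < C ∧ ∀ (K : Type) (_ : Field K) (_ : NumberField K) (A₁ A₂ : ℕ) (α β : 𝓞 K),
      IsPureCubicPair A₁ A₂ α β →
      (Nat.card {c : ClassGroup (𝓞 K) // c ^ ℓ = 1} : ℝ) *
        ((A₁ : ℝ) ^ 2 * A₂) ^ (1 / (3 * (ℓ : ℝ))) ≤ C * ((A₁ * A₂ : ℕ) : ℝ) ^ (1 + 2 * ε) := by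
  set δ : ℝ := min ε 1 / 2 with hδ
  have hδ0 : 0 < δ := by positivity
  have hδ1 : δ < 1 := by have := min_le_right ε 1; linarith
  have hδε : 3 * δ ≤ 2 * ε := by have := min_le_left ε 1; linarith
  obtain ⟨c, hc, hprimes⟩ := exists_rpow_le_card_primes_two_mod_three hδ0 hδ1
  obtain ⟨C₁, hC₁, hlog⟩ := exists_log_add_one_pow_le_rpow hδ0 4
  have hs : 1 < 1 + δ := by linarith
  have hℓ' : (0 : ℝ) < ℓ := Nat.cast_pos.mpr hℓ
  have hℓ1 : (1 : ℝ) ≤ ℓ := by exact_mod_cast hℓ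
  set C₂ : ℝ := 2 * ((∑' k : ℕ, 1 / (k : ℝ) ^ (1 + δ)) ^ 3 * 47 ^ (1 + δ) * (41 * ℓ) ^ 3) with hC₂
  have hC₂0 : 0 ≤ C₂ := by positivity
  refine ⟨7 / c * C₂ * C₁ + 1, by positivity, fun K _ _ A₁ A₂ α β h ↦ ?_⟩
  have h₁ : (0 : ℝ) < A₁ := Nat.cast_pos.mpr h.pos₁
  have h₂ : (0 : ℝ) < A₂ := Nat.cast_pos.mpr h.pos₂
  have hT0 : A₁ * A₂ ≠ 0 := (Nat.mul_pos h.pos₁ h.pos₂).ne'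
  have hT1 : (1 : ℝ) ≤ (A₁ * A₂ : ℕ) := by exact_mod_cast Nat.one_le_iff_ne_zero.mpr hT0
  have hTpos : (0 : ℝ) < (A₁ * A₂ : ℕ) := by linarith
  set Y : ℝ := ((A₁ : ℝ) ^ 2 * A₂) ^ (1 / (3 * (ℓ : ℝ))) with hY
  have hYpos : 0 < Y := by positivity
  have hYpow : Y ^ (3 * ℓ) = (A₁ : ℝ) ^ 2 * A₂ := by
    rw [hY, ← Real.rpow_mul_natCast (by positivity)]
    push_cast
    rw [one_div_mul_cancel (by positivity), Real.rpow_one]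
  have hYT : Y ≤ (A₁ * A₂ : ℕ) := by
    refine le_of_pow_le_pow_left₀ (n := 3 * ℓ) (by omega) hTpos.le ?_
    rw [hYpow]
    refine le_trans ?_ (pow_le_pow_right₀ hT1 (show 2 ≤ 3 * ℓ by omega))
    have : (1 : ℝ) ≤ A₂ := by exact_mod_cast h.pos₂
    push_cast
    rw [mul_pow]
    gcongr
    nlinarith
  have hX : 27 * (2 * (Y / 7) ^ ℓ) ^ 3 < (A₁ : ℝ) ^ 2 * A₂ := by
    have h7 : (343 : ℝ) ≤ 7 ^ (3 * ℓ) := by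
      calc (343 : ℝ) = 7 ^ 3 := by norm_num
        _ ≤ _ := pow_le_pow_right₀ (by norm_num) (by omega)
    have : 27 * (2 * (Y / 7) ^ ℓ) ^ 3 = 216 * ((A₁ : ℝ) ^ 2 * A₂) / 7 ^ (3 * ℓ) := by
      rw [← hYpow, mul_pow, ← pow_mul, div_pow, mul_comm ℓ 3]
      ring
    rw [this, div_lt_iff₀ (by positivity)]
    have : (0 : ℝ) < (A₁ : ℝ) ^ 2 * A₂ := by positivity
    nlinarith
  have key := h.card_torsion_mul_card_primes_le hℓ hs (X := Y / 7) (by positivity)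
    ((div_le_self hYpos.le (by norm_num)).trans hYT) hX
  rw [← hC₂] at key
  have hp := hprimes (Y / 7) (by positivity)
  have hl := hlog _ hT0
  generalize ((((Finset.range (⌊Y / 7⌋₊ + 1)).filter
    fun p ↦ p.Prime ∧ p % 3 = 2).card : ℕ) : ℝ) = π at key hp
  have hN : (0 : ℝ) ≤ Nat.card {c : ClassGroup (𝓞 K) // c ^ ℓ = 1} := Nat.cast_nonneg _
  generalize (Nat.card {c : ClassGroup (𝓞 K) // c ^ ℓ = 1} : ℝ) = N at *
  generalize A₁ * A₂ = T at *
  have hYδ : Y / 7 ≤ (Y / 7) ^ (1 - δ) * (T : ℝ) ^ δ := by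
    calc Y / 7 = (Y / 7) ^ (1 - δ) * (Y / 7) ^ δ := by
          rw [← Real.rpow_add (by positivity)]; simp
      _ ≤ _ := by
        gcongr
        exact (div_le_self hYpos.le (by norm_num)).trans hYT
  calc N * Y = 7 / c * (N * (c * (Y / 7))) := by field_simp
    _ ≤ 7 / c * (N * (c * ((Y / 7) ^ (1 - δ) * (T : ℝ) ^ δ))) := by gcongr
    _ = 7 / c * (N * (c * (Y / 7) ^ (1 - δ)) * (T : ℝ) ^ δ) := by ring
    _ ≤ 7 / c * (N * (π + 1) * (T : ℝ) ^ δ) := by gcongr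
    _ ≤ 7 / c * (C₂ * ((Nat.log 2 T : ℝ) + 1) ^ 4 * (T : ℝ) ^ (1 + δ) * (T : ℝ) ^ δ) := by gcongr
    _ ≤ 7 / c * (C₂ * (C₁ * (T : ℝ) ^ δ) * (T : ℝ) ^ (1 + δ) * (T : ℝ) ^ δ) := by gcongr
    _ = 7 / c * C₂ * C₁ * (T : ℝ) ^ (1 + 3 * δ) := by
      rw [show 1 + 3 * δ = δ + (1 + δ) + δ by ring,
        Real.rpow_add hTpos (δ + (1 + δ)) δ, Real.rpow_add hTpos δ (1 + δ)]
      ring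
    _ ≤ _ := by
      gcongr
      · linarith

end Torsion

/-- torsion bound for pure cubic fields `K = ℚ((A₁A₂²)^{1/3})`. -/
theorem torsion_pure_cubic (ℓ : ℕ) (hℓ : 0 < ℓ) (ε : ℝ) (hε : 0 < ε) :
    ∃ C : ℝ, 0 < C ∧
      ∀ (K : Type) (_ : Field K) (_ : NumberField K) (A₁ A₂ a : ℕ) (θ : K),
        Squarefree A₁ → Squarefree A₂ → Nat.Coprime A₁ A₂ → 0 < A₁ → 0 < A₂ →
        a = A₁ * A₂ ^ 2 → 1 < a → (¬ ∃ b : ℕ, b ^ 3 = a) →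
        θ ^ 3 = (a : K) → IntermediateField.adjoin ℚ {θ} = ⊤ →
        Module.finrank ℚ K = 3 →
        (Nat.card {c : ClassGroup (𝓞 K) // c ^ ℓ = 1} : ℝ) ≤
          C * (DK K : ℝ) ^ ((1 : ℝ) / 2 - 1 / (3 * (ℓ : ℝ)) + ε) *
            (A₂ : ℝ) ^ ((1 : ℝ) / (3 * (ℓ : ℝ))) := by
  obtain ⟨C, hC, hbound⟩ := card_torsion_le_of_isPureCubicPair ℓ hℓ ε hε
  have hℓ1 : (1 : ℝ) ≤ ℓ := by exact_mod_cast hℓ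
  set κ : ℝ := 1 / (3 * (ℓ : ℝ)) with hκ
  have hκ3 : κ ≤ 1 / 3 := by
    rw [hκ]; gcongr; linarith
  set e : ℝ := 1 / 2 - κ + ε with he
  have he0 : 0 < e := by linarith
  refine ⟨C * 27 ^ e, by positivity, fun K _ _ A₁ A₂ a θ hA₁ hA₂ hcop h₁ h₂ ha _ _ hθ htop hK ↦ ?_⟩
  obtain ⟨α, β, h⟩ := exists_isPureCubicPair hA₁ hA₂ hcop ha hθ htop hK
  have h₁' : (0 : ℝ) < A₁ := Nat.cast_pos.mpr h₁
  have h₂' : (0 : ℝ) < A₂ := Nat.cast_pos.mpr h₂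
  have hD : ((A₁ * A₂ : ℝ)) ^ 2 ≤ 27 * (DK K : ℝ) := by
    exact_mod_cast h.natAbs_discr_bounds.1
  have hY : (0 : ℝ) < ((A₁ : ℝ) ^ 2 * A₂) ^ κ := by positivity
  refine le_of_mul_le_mul_right ((hbound K _ _ A₁ A₂ α β h).trans ?_) hY
  have hsplit : ((A₁ * A₂ : ℕ) : ℝ) ^ (1 + 2 * ε) =
      ((A₁ * A₂ : ℝ) ^ 2) ^ e * (A₂ : ℝ) ^ κ * ((A₁ : ℝ) ^ 2 * A₂) ^ κ := by
    rw [mul_assoc, ← Real.mul_rpow (by positivity) (by positivity),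
      show (A₂ : ℝ) * ((A₁ : ℝ) ^ 2 * A₂) = (A₁ * A₂) ^ 2 by ring,
      ← Real.rpow_add (by positivity), ← Real.rpow_natCast_mul (by positivity)]
    push_cast
    congr 1
    rw [he]; ring
  calc C * ((A₁ * A₂ : ℕ) : ℝ) ^ (1 + 2 * ε)
      = C * (((A₁ * A₂ : ℝ) ^ 2) ^ e * (A₂ : ℝ) ^ κ * ((A₁ : ℝ) ^ 2 * A₂) ^ κ) := by rw [hsplit]
    _ ≤ C * ((27 * (DK K : ℝ)) ^ e * (A₂ : ℝ) ^ κ * ((A₁ : ℝ) ^ 2 * A₂) ^ κ) := by gcongr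
    _ = _ := by
      rw [Real.mul_rpow (by norm_num) (by positivity)]
      ring
end
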